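/- Let d ≥ 1, p,q ∈ (1,∞) and 1 < β ≤ d/p + 2/q, and set r := βp/(β−1), s := βq/(β−1). There is a constant N depending only on d, p, q, β such that for every u ∈ E^{1,2}_{p,q,β}: ‖Du‖_{E_{r,s,β−1}} ≤ N·‖u‖_{E^{1,2}_{p,q,β}}. -/

import Mathlib

open MeasureTheory ENNReal NNReal Metric Set Filter Topology

noncomputable section

/-- Euclidean space `ℝ^d`. -/
abbrev Spc (d : ℕ) : Type := EuclideanSpace ℝ (Fin d)

/-- Space-time `ℝ^{d+1} = ℝ × ℝ^d`, a point is `(t, x)`. -/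
abbrev SpT (d : ℕ) : Type := ℝ × Spc d

/-- The parabolic cylinder `C_ρ(t₀,x₀) = [t₀, t₀+ρ²) × B_ρ(x₀)`. -/
def pCyl (d : ℕ) (ρ t₀ : ℝ) (x₀ : Spc d) : Set (SpT d) :=
  (Set.Ico t₀ (t₀ + ρ ^ 2)) ×ˢ (Metric.ball x₀ ρ)

/-- The (unnormalized) norm `‖f‖_{L_{p,q}(A)}
    = (∫_ℝ (∫_{ℝ^d} |f(t,x)|^p 1_A(t,x) dx)^{q/p} dt)^{1/q}`. -/
def lpqNorm (d : ℕ) (p q : ℝ) (f : SpT d → ℝ) (A : Set (SpT d)) : ℝ≥0∞ :=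
  (∫⁻ t : ℝ, (∫⁻ x : Spc d, A.indicator (fun z => ENNReal.ofReal |f z| ^ p) (t, x)) ^ (q / p)) ^ (1 / q)

/-- The normalized norm `⨍‖f‖_{L_{p,q}(C)}` over the cylinder `C_ρ(t₀,x₀)`:
    inner integral replaced by the average over the spatial ball, outer one
    by the average over the time interval. -/
def avgLpq (d : ℕ) (p q ρ t₀ : ℝ) (x₀ : Spc d) (f : SpT d → ℝ) : ℝ≥0∞ :=
  ((∫⁻ t in Set.Ico t₀ (t₀ + ρ ^ 2),
      ((∫⁻ x in Metric.ball x₀ ρ, ENNReal.ofReal |f (t, x)| ^ p) / volume (Metric.ball x₀ ρ)) ^ (q / p))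
      / ENNReal.ofReal (ρ ^ 2)) ^ (1 / q)

/-- The parabolic Morrey norm `‖f‖_{E_{p,q,β}}
    = sup { ρ^β ⨍‖f‖_{L_{p,q}(C)} : 0 < ρ ≤ 1, C ∈ ℂ_ρ }`. -/
def morreyNorm (d : ℕ) (p q β : ℝ) (f : SpT d → ℝ) : ℝ≥0∞ :=
  ⨆ (ρ : ℝ) (_ : 0 < ρ) (_ : ρ ≤ 1) (t₀ : ℝ) (x₀ : Spc d),
    ENNReal.ofReal (ρ ^ β) * avgLpq d p q ρ t₀ x₀ f

/-- The homogeneous parabolic Morrey norm `‖f‖_{Ė_{p,q,β}}` (all radii `ρ > 0`). -/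
def morreyNormH (d : ℕ) (p q β : ℝ) (f : SpT d → ℝ) : ℝ≥0∞ :=
  ⨆ (ρ : ℝ) (_ : 0 < ρ) (t₀ : ℝ) (x₀ : Spc d),
    ENNReal.ofReal (ρ ^ β) * avgLpq d p q ρ t₀ x₀ f

/-- Membership `f ∈ E_{p,q,β}`. -/
def MemE (d : ℕ) (p q β : ℝ) (f : SpT d → ℝ) : Prop :=
  AEStronglyMeasurable f volume ∧ morreyNorm d p q β f ≠ ⊤

/-- Membership `f ∈ Ė_{p,q,β}` (homogeneous). -/
def MemEH (d : ℕ) (p q β : ℝ) (f : SpT d → ℝ) : Prop :=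
  AEStronglyMeasurable f volume ∧ morreyNormH d p q β f ≠ ⊤

/-- The elliptic Morrey norm `‖f‖_{E_{p,β}(ℝ^d)}
    = sup { ρ^β (⨍_{B_ρ(x)} |f|^p)^{1/p} : 0 < ρ ≤ 1, x ∈ ℝ^d }`. -/
def morreyNormE (d : ℕ) (p β : ℝ) (f : Spc d → ℝ) : ℝ≥0∞ :=
  ⨆ (ρ : ℝ) (_ : 0 < ρ) (_ : ρ ≤ 1) (x₀ : Spc d),
    ENNReal.ofReal (ρ ^ β) *
      ((∫⁻ y in Metric.ball x₀ ρ, ENNReal.ofReal |f y| ^ p) / volume (Metric.ball x₀ ρ)) ^ (1 / p)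

/-- The homogeneous elliptic Morrey norm on `ℝ^d` (all radii `ρ > 0`). -/
def morreyNormEH (d : ℕ) (p β : ℝ) (f : Spc d → ℝ) : ℝ≥0∞ :=
  ⨆ (ρ : ℝ) (_ : 0 < ρ) (x₀ : Spc d),
    ENNReal.ofReal (ρ ^ β) *
      ((∫⁻ y in Metric.ball x₀ ρ, ENNReal.ofReal |f y| ^ p) / volume (Metric.ball x₀ ρ)) ^ (1 / p)

/-- A mollifying kernel: nonnegative, smooth, compactly supported in
    `[-1,0) × B_1(0)`, with unit integral. -/
def IsMollifier (d : ℕ) (ζ : SpT d → ℝ) : Prop :=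
  ContDiff ℝ (⊤ : ℕ∞) ζ ∧ (∀ z, 0 ≤ ζ z) ∧ (∫ z, ζ z) = 1 ∧
    Function.support ζ ⊆ (Set.Ico (-1 : ℝ) 0) ×ˢ (Metric.ball (0 : Spc d) 1)

/-- The mollification `f^{(ε)} = f * ζ_ε`, where
    `ζ_ε(t,x) = ε^{-d-2} ζ(t/ε², x/ε)`. -/
def mollify (d : ℕ) (ζ : SpT d → ℝ) (ε : ℝ) (f : SpT d → ℝ) (z : SpT d) : ℝ :=
  ∫ w : SpT d, (ε ^ (-(d : ℝ) - 2) * ζ (w.1 / ε ^ 2, ε⁻¹ • w.2)) * f (z.1 - w.1, z.2 - w.2)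

/-- The time direction in space-time. -/
def dirT (d : ℕ) : SpT d := (1, 0)

/-- The `i`-th spatial direction in space-time. -/
def dirS (d : ℕ) (i : Fin d) : SpT d := (0, EuclideanSpace.single i 1)

/-- `v` is the weak derivative of `u` in the direction `e`. -/
def IsWeakDeriv (d : ℕ) (u v : SpT d → ℝ) (e : SpT d) : Prop :=
  ∀ φ : SpT d → ℝ, ContDiff ℝ (⊤ : ℕ∞) φ → HasCompactSupport φ →
    ∫ z, u z * fderiv ℝ φ z e = - ∫ z, v z * φ z

/-- `v` is the second weak derivative of `u` in the directions `e₁, e₂`. -/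
def IsWeakDeriv2 (d : ℕ) (u v : SpT d → ℝ) (e₁ e₂ : SpT d) : Prop :=
  ∀ φ : SpT d → ℝ, ContDiff ℝ (⊤ : ℕ∞) φ → HasCompactSupport φ →
    ∫ z, u z * fderiv ℝ (fun w => fderiv ℝ φ w e₁) z e₂ = ∫ z, v z * φ z

/-- The magnitude `|Du|` of the spatial gradient. -/
def gradMag (d : ℕ) (Du : Fin d → SpT d → ℝ) (z : SpT d) : ℝ :=
  Real.sqrt (∑ i, (Du i z) ^ 2)

/-- The magnitude `|D²u|` of the spatial Hessian. -/
def hessMag (d : ℕ) (D2u : Fin d → Fin d → SpT d → ℝ) (z : SpT d) : ℝ :=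
  Real.sqrt (∑ i, ∑ j, (D2u i j z) ^ 2)

/-- `u ∈ E^{1,2}_{p,q,β}`, with weak spatial gradient `Du`, weak spatial Hessian
    `D2u`, and weak time derivative `ut`, all in `E_{p,q,β}`. -/
def Mem12 (d : ℕ) (p q β : ℝ) (u : SpT d → ℝ) (Du : Fin d → SpT d → ℝ)
    (D2u : Fin d → Fin d → SpT d → ℝ) (ut : SpT d → ℝ) : Prop :=
  MemE d p q β u ∧ (∀ i, IsWeakDeriv d u (Du i) (dirS d i)) ∧
    (∀ i j, IsWeakDeriv2 d u (D2u i j) (dirS d i) (dirS d j)) ∧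
    IsWeakDeriv d u ut (dirT d) ∧
    (∀ i, MemE d p q β (Du i)) ∧ (∀ i j, MemE d p q β (D2u i j)) ∧ MemE d p q β ut

/-- `u ∈ Ė^{1,2}_{p,q,β}` (homogeneous version). -/
def Mem12H (d : ℕ) (p q β : ℝ) (u : SpT d → ℝ) (Du : Fin d → SpT d → ℝ)
    (D2u : Fin d → Fin d → SpT d → ℝ) (ut : SpT d → ℝ) : Prop :=
  MemEH d p q β u ∧ (∀ i, IsWeakDeriv d u (Du i) (dirS d i)) ∧
    (∀ i j, IsWeakDeriv2 d u (D2u i j) (dirS d i) (dirS d j)) ∧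
    IsWeakDeriv d u ut (dirT d) ∧
    (∀ i, MemEH d p q β (Du i)) ∧ (∀ i j, MemEH d p q β (D2u i j)) ∧ MemEH d p q β ut

/-- The norm `‖u‖_{E^{1,2}_{p,q,β}} = ‖u‖ + ‖Du‖ + ‖D²u‖ + ‖∂ₜu‖`. -/
def norm12 (d : ℕ) (p q β : ℝ) (u : SpT d → ℝ) (Du : Fin d → SpT d → ℝ)
    (D2u : Fin d → Fin d → SpT d → ℝ) (ut : SpT d → ℝ) : ℝ≥0∞ :=
  morreyNorm d p q β u + morreyNorm d p q β (gradMag d Du)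
    + morreyNorm d p q β (hessMag d D2u) + morreyNorm d p q β ut

/-- Membership `f ∈ L_{p,q}(ℝ^{d+1})`. -/
def MemLpq (d : ℕ) (p q : ℝ) (f : SpT d → ℝ) : Prop :=
  AEStronglyMeasurable f volume ∧ lpqNorm d p q f Set.univ ≠ ⊤

/-- `u ∈ W^{1,2}_{p,q}(ℝ^{d+1})`: `u`, its weak spatial gradient `Du`,
    weak spatial Hessian `D2u` and weak time derivative `ut` are in `L_{p,q}`. -/
def MemW12 (d : ℕ) (p q : ℝ) (u : SpT d → ℝ) (Du : Fin d → SpT d → ℝ)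
    (D2u : Fin d → Fin d → SpT d → ℝ) (ut : SpT d → ℝ) : Prop :=
  MemLpq d p q u ∧ (∀ i, IsWeakDeriv d u (Du i) (dirS d i)) ∧
    (∀ i j, IsWeakDeriv2 d u (D2u i j) (dirS d i) (dirS d j)) ∧
    IsWeakDeriv d u ut (dirT d) ∧
    (∀ i, MemLpq d p q (Du i)) ∧ (∀ i j, MemLpq d p q (D2u i j)) ∧ MemLpq d p q ut

/-- Convergence `F ε → v` in `L_r(B)` as `ε ↓ 0`. -/
def TendstoLr (d : ℕ) (r : ℝ) (B : Set (Spc d)) (F : ℝ → Spc d → ℝ) (v : Spc d → ℝ) : Prop :=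
  Tendsto (fun ε => (∫⁻ x in B, ENNReal.ofReal |F ε x - v x| ^ r) ^ (1 / r))
    (𝓝[>] (0 : ℝ)) (𝓝 0)

/-- The truncated potential of order one
    `f ↦ ∫_0^R ∫ η(w) f(x - s w) dw ds` generated by the density `η`. -/
def truncPot {d : ℕ} (η : Spc d → ℝ≥0∞) (R : ℝ) (f : Spc d → ℝ≥0∞) (x : Spc d) : ℝ≥0∞ :=
  ∫⁻ s in Ioc 0 R, ∫⁻ w, η w * f (x - s • w)

/-- The weight obtained by optimizing the truncation radius at height `a`. -/
def optWeight (β γ K s a : ℝ) : ℝ :=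
  (max s ((K / (2 * a)) ^ (1 / β))) ^ (-γ)

lemma truncPot_const_le {d : ℕ} {η : Spc d → ℝ≥0∞} (hη1 : ∫⁻ w, η w = 1) {R : ℝ}
    (μ : ℝ≥0∞) (f : Spc d → ℝ≥0∞) (hf : ∀ y, f y ≤ μ) (x : Spc d) :
    truncPot η R f x ≤ ENNReal.ofReal R * μ := by
  calc truncPot η R f x ≤ ∫⁻ s in Ioc 0 R, μ := by
        refine lintegral_mono fun s => ?_
        calc ∫⁻ w, η w * f (x - s • w) ≤ ∫⁻ w, μ * η w :=
              lintegral_mono fun w => by rw [mul_comm]; gcongr; exact hf _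
          _ ≤ μ := by
              by_cases hμ : μ = ⊤
              · simp [hμ]
              · rw [lintegral_const_mul' _ _ hμ, hη1, mul_one]
    _ = ENNReal.ofReal R * μ := by simp [mul_comm]

lemma measurable_truncPot_integrand {d : ℕ} {η : Spc d → ℝ≥0∞} (hη : Measurable η)
    {f : Spc d → ℝ≥0∞} (hf : Measurable f) (x : Spc d) :
    Measurable (Function.uncurry fun (s : ℝ) (w : Spc d) => η w * f (x - s • w)) := by
  unfold Function.uncurry
  fun_prop

lemma truncPot_add {d : ℕ} {η : Spc d → ℝ≥0∞} (hη : Measurable η) {R : ℝ}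
    {f g : Spc d → ℝ≥0∞} (hf : Measurable f) (x : Spc d) :
    truncPot η R (fun y => f y + g y) x = truncPot η R f x + truncPot η R g x := by
  unfold truncPot
  rw [← lintegral_add_left]
  · refine lintegral_congr fun s => ?_
    rw [← lintegral_add_left]
    · simp only [mul_add]
    · fun_prop
  · exact (measurable_truncPot_integrand hη hf x).lintegral_prod_right

/-- Pointwise Hedberg-type inequality: an infimum over truncation radii is dominated by a
    linear expression. -/
lemma rpow_le_of_forall_radius {d : ℕ} {η : Spc d → ℝ≥0∞} (hη : Measurable η)
    (hη1 : ∫⁻ w, η w = 1) {β r K ρ g : ℝ} (hβ : 1 < β) (hr : 1 < r) (hK : 0 < K) (hρ : 0 < ρ)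
    (hg : 0 ≤ g) {a : Spc d → ℝ} (ha : Measurable a) (x : Spc d)
    (h : ∀ R, 0 < R → R ≤ ρ →
      ENNReal.ofReal g ≤ truncPot η R (fun y => ENNReal.ofReal (a y)) x
        + ENNReal.ofReal (R ^ (1 - β) * K)) :
    ENNReal.ofReal (g ^ r) ≤ ENNReal.ofReal ((2 * (ρ ^ (1 - β) * K)) ^ r)
      + ∫⁻ s in Ioc 0 ρ, ∫⁻ w, η w *
          (ENNReal.ofReal (4 * (2 * K) ^ (r - 1) *
            (a (x - s • w) * optWeight β ((β - 1) * (r - 1)) K s (a (x - s • w))))) := by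
  by_cases hcase : g ≤ 2 * (ρ ^ (1 - β) * K)
  · refine le_add_right (ENNReal.ofReal_le_ofReal ?_)
    exact Real.rpow_le_rpow hg hcase (by linarith)
  push Not at hcase
  have hgpos : 0 < g := lt_of_le_of_lt (by positivity) hcase
  have hb : 0 < β - 1 := by linarith
  set R : ℝ := (2 * K / g) ^ (1 / (β - 1)) with hR
  have hRpos : 0 < R := by positivity
  have hgR : g = 2 * (R ^ (1 - β) * K) := by
    have : R ^ (1 - β) = g / (2 * K) := by
      rw [hR, ← Real.rpow_mul (by positivity),
        show 1 / (β - 1) * (1 - β) = -1 by field_simp; ring, Real.rpow_neg_one, inv_div]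
    rw [this]; field_simp
  have hRρ : R ≤ ρ := by
    by_contra hlt
    push Not at hlt
    have : R ^ (1 - β) ≤ ρ ^ (1 - β) :=
      Real.rpow_le_rpow_of_nonpos hρ hlt.le (by linarith)
    have : R ^ (1 - β) * K ≤ ρ ^ (1 - β) * K := by gcongr
    linarith
  set μ : ℝ := g / (4 * R) with hμ
  set f1 : Spc d → ℝ≥0∞ := fun y => if μ < a y then ENNReal.ofReal (a y) else 0 with hf1
  set f2 : Spc d → ℝ≥0∞ := fun y => if μ < a y then 0 else ENNReal.ofReal (a y) with hf2
  have hs : MeasurableSet {y | μ < a y} := measurableSet_lt measurable_const ha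
  have hf1m : Measurable f1 := Measurable.ite hs (by fun_prop) measurable_const
  have hsum : (fun y => ENNReal.ofReal (a y)) = fun y => f1 y + f2 y := by
    ext y; simp only [hf1, hf2]; split_ifs <;> simp
  have h2 : truncPot η R f2 x ≤ ENNReal.ofReal (g / 4) := by
    refine (truncPot_const_le hη1 (ENNReal.ofReal μ) f2 (fun y => ?_) x).trans ?_
    · simp only [hf2]; split_ifs with hy
      · simp
      · exact ENNReal.ofReal_le_ofReal (not_lt.1 hy)
    · rw [← ENNReal.ofReal_mul hRpos.le]
      apply ENNReal.ofReal_le_ofReal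
      rw [hμ]; apply le_of_eq; field_simp
  have h1 : ENNReal.ofReal (g / 4) ≤ truncPot η R f1 x := by
    have := h R hRpos hRρ
    rw [hsum, truncPot_add hη hf1m, show R ^ (1 - β) * K = g / 2 by rw [hgR]; ring] at this
    have h3 : ENNReal.ofReal g ≤ truncPot η R f1 x + ENNReal.ofReal (3 * g / 4) := by
      refine this.trans ?_
      rw [add_assoc]
      gcongr
      refine (add_le_add_left h2 _).trans ?_
      rw [← ENNReal.ofReal_add (by positivity) (by positivity)]
      apply ENNReal.ofReal_le_ofReal; linarith
    have h4 : ENNReal.ofReal g = ENNReal.ofReal (g / 4) + ENNReal.ofReal (3 * g / 4) := by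
      rw [← ENNReal.ofReal_add (by positivity) (by positivity)]; congr 1; ring
    rw [h4] at h3
    exact (ENNReal.add_le_add_iff_right ENNReal.ofReal_ne_top).1 h3
  refine le_add_left ?_
  have hpow : g ^ r = (4 * g ^ (r - 1)) * (g / 4) := by
    rw [show r = (r - 1) + 1 by ring, Real.rpow_add hgpos, Real.rpow_one]
    ring_nf
  have hgr : g ^ (r - 1) = (2 * K) ^ (r - 1) * R ^ (-((β - 1) * (r - 1))) := by
    rw [hgR, show 2 * (R ^ (1 - β) * K) = (2 * K) * R ^ (1 - β) by ring,
      Real.mul_rpow (by positivity) (by positivity), ← Real.rpow_mul hRpos.le]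
    congr 2; ring
  rw [hpow, ENNReal.ofReal_mul (by positivity)]
  calc ENNReal.ofReal (4 * g ^ (r - 1)) * ENNReal.ofReal (g / 4)
      ≤ ENNReal.ofReal (4 * g ^ (r - 1)) * truncPot η R f1 x := by gcongr
    _ = ∫⁻ s in Ioc 0 R, ∫⁻ w, η w * (ENNReal.ofReal (4 * g ^ (r - 1)) * f1 (x - s • w)) := by
        rw [truncPot, ← lintegral_const_mul' _ _ ENNReal.ofReal_ne_top]
        refine lintegral_congr fun s => ?_
        rw [← lintegral_const_mul' _ _ ENNReal.ofReal_ne_top]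
        refine lintegral_congr fun w => ?_
        ring
    _ ≤ ∫⁻ s in Ioc 0 R, ∫⁻ w, η w *
          (ENNReal.ofReal (4 * (2 * K) ^ (r - 1) *
            (a (x - s • w) * optWeight β ((β - 1) * (r - 1)) K s (a (x - s • w))))) := by
        refine setLIntegral_mono' measurableSet_Ioc fun s hs => lintegral_mono fun w => ?_
        gcongr
        simp only [hf1]
        split_ifs with hy
        · set A := a (x - s • w)
          have hμpos : 0 < μ := by positivity
          have hA : 0 < A := hμpos.trans hy
          rw [← ENNReal.ofReal_mul (by positivity)]
          apply ENNReal.ofReal_le_ofReal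
          have hmax : max s ((K / (2 * A)) ^ (1 / β)) ≤ R := by
            refine max_le hs.2 ?_
            have : K / (2 * A) ≤ R ^ β := by
              have e : μ = K / (2 * R ^ β) := by
                rw [hμ, hgR, show (1 - β) = -β + 1 by ring, Real.rpow_add hRpos, Real.rpow_one,
                  Real.rpow_neg hRpos.le]
                field_simp; ring
              rw [e] at hy
              rw [div_lt_iff₀ (by positivity)] at hy
              rw [div_le_iff₀ (by positivity)]
              nlinarith
            calc (K / (2 * A)) ^ (1 / β) ≤ (R ^ β) ^ (1 / β) :=
                  Real.rpow_le_rpow (by positivity) this (by positivity)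
              _ = R := by
                  rw [← Real.rpow_mul hRpos.le, mul_one_div_cancel (by positivity), Real.rpow_one]
          have hmpos : 0 < max s ((K / (2 * A)) ^ (1 / β)) := lt_max_of_lt_left hs.1
          have : R ^ (-((β - 1) * (r - 1))) ≤ optWeight β ((β - 1) * (r - 1)) K s A :=
            Real.rpow_le_rpow_of_nonpos hmpos hmax
              (neg_nonpos.2 (mul_nonneg hb.le (by linarith)))
          rw [hgr]
          calc 4 * ((2 * K) ^ (r - 1) * R ^ (-((β - 1) * (r - 1)))) * A
              = 4 * (2 * K) ^ (r - 1) * (A * R ^ (-((β - 1) * (r - 1)))) := by ring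
            _ ≤ _ := by gcongr
        · simp
    _ ≤ _ := lintegral_mono_set (Ioc_subset_Ioc_right hRρ)

lemma lintegral_max_rpow_le {γ c : ℝ} (hγ : 1 < γ) (hc : 0 < c) (ρ : ℝ) :
    ∫⁻ s in Ioc 0 ρ, ENNReal.ofReal ((max s c) ^ (-γ))
      ≤ ENNReal.ofReal (γ / (γ - 1) * c ^ (1 - γ)) := by
  have hint : IntegrableOn (fun s : ℝ => s ^ (-γ)) (Ioi c) :=
    integrableOn_Ioi_rpow_of_lt (by linarith) hc
  calc ∫⁻ s in Ioc 0 ρ, ENNReal.ofReal ((max s c) ^ (-γ))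
      ≤ ∫⁻ s in Ioc 0 c ∪ Ioi c, ENNReal.ofReal ((max s c) ^ (-γ)) := by
        refine lintegral_mono_set fun s hs => ?_
        rcases le_or_gt s c with h | h
        · exact Or.inl ⟨hs.1, h⟩
        · exact Or.inr h
    _ ≤ (∫⁻ s in Ioc 0 c, ENNReal.ofReal ((max s c) ^ (-γ)))
          + ∫⁻ s in Ioi c, ENNReal.ofReal ((max s c) ^ (-γ)) := lintegral_union_le _ _ _
    _ = (∫⁻ s in Ioc 0 c, ENNReal.ofReal (c ^ (-γ)))
          + ∫⁻ s in Ioi c, ENNReal.ofReal (s ^ (-γ)) := by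
        congr 1
        · exact setLIntegral_congr_fun measurableSet_Ioc fun s hs => by
            simp only [max_eq_right hs.2]
        · exact setLIntegral_congr_fun measurableSet_Ioi fun s hs => by
            simp only [max_eq_left (mem_Ioi.1 hs).le]
    _ = ENNReal.ofReal (γ / (γ - 1) * c ^ (1 - γ)) := by
        rw [← ofReal_integral_eq_lintegral_ofReal hint, integral_Ioi_rpow_of_lt (by linarith) hc,
          setLIntegral_const, Real.volume_Ioc, sub_zero, ← ENNReal.ofReal_mul (by positivity),
          ← ENNReal.ofReal_add (by positivity)]
        · congr 1
          rw [show (1 - γ) = -γ + 1 by ring, Real.rpow_add hc, Real.rpow_one]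
          have : γ - 1 ≠ 0 := by linarith
          have : -γ + 1 ≠ 0 := by linarith
          field_simp
          ring
        · rw [show -γ + 1 = -(γ - 1) by ring, neg_div_neg_eq]
          have : 0 < γ - 1 := by linarith
          positivity
        · filter_upwards [ae_restrict_mem measurableSet_Ioi] with s hs
          exact Real.rpow_nonneg (hc.trans hs).le _

lemma lintegral_mul_optWeight_le {p β K : ℝ} (hp : 1 < p) (hβ : 1 < β) (hK : 0 < K) (ρ : ℝ)
    {a : ℝ} (ha : 0 ≤ a) :
    ∫⁻ s in Ioc 0 ρ, ENNReal.ofReal (4 * (2 * K) ^ (β * p / (β - 1) - 1) *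
        (a * optWeight β ((β - 1) * (β * p / (β - 1) - 1)) K s a))
      ≤ ENNReal.ofReal (4 * 2 ^ (β * p / (β - 1) - 1 + (p - 1)) *
          ((β * (p - 1) + 1) / (β * (p - 1))) * K ^ (β * p / (β - 1) - p)) *
          ENNReal.ofReal (a ^ p) := by
  have hb : 0 < β - 1 := by linarith
  rcases ha.eq_or_lt with rfl | ha
  · simp
  have hp1 : 0 < p - 1 := by linarith
  set r := β * p / (β - 1) with hr
  have hγ : (β - 1) * (r - 1) = β * (p - 1) + 1 := by
    rw [hr]; field_simp; ring
  have hγ1 : 0 < β * (p - 1) := by positivity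
  set c := (K / (2 * a)) ^ (1 / β) with hc
  have hcpos : 0 < c := by positivity
  have hcp : c ^ (1 - (β * (p - 1) + 1)) = (2 * a / K) ^ (p - 1) := by
    rw [hc, ← Real.rpow_mul (by positivity),
      show 1 / β * (1 - (β * (p - 1) + 1)) = -(p - 1) by field_simp; ring,
      Real.rpow_neg (by positivity), ← Real.inv_rpow (by positivity), inv_div]
  rw [hγ]
  calc ∫⁻ s in Ioc 0 ρ, ENNReal.ofReal (4 * (2 * K) ^ (r - 1) *
        (a * optWeight β (β * (p - 1) + 1) K s a))
      = ENNReal.ofReal (4 * (2 * K) ^ (r - 1) * a) *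
          ∫⁻ s in Ioc 0 ρ, ENNReal.ofReal ((max s c) ^ (-(β * (p - 1) + 1))) := by
        rw [← lintegral_const_mul' _ _ ENNReal.ofReal_ne_top]
        refine lintegral_congr fun s => ?_
        rw [← ENNReal.ofReal_mul (by positivity), optWeight, hc]
        congr 1
        ring
    _ ≤ ENNReal.ofReal (4 * (2 * K) ^ (r - 1) * a) *
          ENNReal.ofReal ((β * (p - 1) + 1) / (β * (p - 1)) * (2 * a / K) ^ (p - 1)) := by
        gcongr
        refine (lintegral_max_rpow_le (by linarith) hcpos ρ).trans ?_
        rw [hcp, show β * (p - 1) + 1 - 1 = β * (p - 1) by ring]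
    _ = _ := by
        rw [← ENNReal.ofReal_mul (by positivity), ← ENNReal.ofReal_mul (by positivity)]
        congr 1
        have e1 : (2 * K) ^ (r - 1) = 2 ^ (r - 1) * K ^ (r - 1) :=
          Real.mul_rpow (by norm_num) hK.le
        have e2 : (2 * a / K) ^ (p - 1) = 2 ^ (p - 1) * a ^ (p - 1) * (K ^ (p - 1))⁻¹ := by
          rw [Real.div_rpow (by positivity) hK.le, Real.mul_rpow (by norm_num) ha.le]; rfl
        have e3 : K ^ (r - p) = K ^ (r - 1) * (K ^ (p - 1))⁻¹ := by
          rw [← Real.rpow_neg hK.le, ← Real.rpow_add hK]; congr 1; ring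
        have e4 : a ^ p = a ^ (p - 1) * a := by
          conv_lhs => rw [show p = (p - 1) + 1 by ring, Real.rpow_add ha, Real.rpow_one]
        have e5 : (2 : ℝ) ^ (r - 1 + (p - 1)) = 2 ^ (r - 1) * 2 ^ (p - 1) :=
          Real.rpow_add (by norm_num) _ _
        rw [e1, e2, e3, e4, e5]
        ring

/-- Integrated Hedberg-type inequality on a ball. -/
lemma lintegral_rpow_le_of_forall_radius {d : ℕ} {η : Spc d → ℝ≥0∞} (hη : Measurable η)
    (hη1 : ∫⁻ w, η w = 1) (hη0 : ∀ w, w ∉ ball (0 : Spc d) 1 → η w = 0) {p β K ρ : ℝ}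
    (hp : 1 < p) (hβ : 1 < β) (hK : 0 < K) (hρ : 0 < ρ)
    {g : Spc d → ℝ} (hg : ∀ x, 0 ≤ g x) {a : Spc d → ℝ} (ha : Measurable a) (ha0 : ∀ y, 0 ≤ a y)
    (x₀ : Spc d)
    (h : ∀ᵐ x, ∀ R, 0 < R → R ≤ ρ →
      ENNReal.ofReal (g x) ≤ truncPot η R (fun y => ENNReal.ofReal (a y)) x
        + ENNReal.ofReal (R ^ (1 - β) * K)) :
    ∫⁻ x in ball x₀ ρ, ENNReal.ofReal (g x ^ (β * p / (β - 1)))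
      ≤ ENNReal.ofReal ((2 * (ρ ^ (1 - β) * K)) ^ (β * p / (β - 1))) * volume (ball x₀ ρ)
        + ENNReal.ofReal (4 * 2 ^ (β * p / (β - 1) - 1 + (p - 1)) *
          ((β * (p - 1) + 1) / (β * (p - 1))) * K ^ (β * p / (β - 1) - p)) *
          ∫⁻ y in ball x₀ (2 * ρ), ENNReal.ofReal (a y ^ p) := by
  have hb : 0 < β - 1 := by linarith
  set r := β * p / (β - 1) with hr
  have hr1 : 1 < r := by
    rw [hr, lt_div_iff₀ hb]; nlinarith
  set ψ : ℝ → Spc d → ℝ≥0∞ := fun s y => ENNReal.ofReal (4 * (2 * K) ^ (r - 1) *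
            (a y * optWeight β ((β - 1) * (r - 1)) K s (a y))) with hψ
  have hψm : Measurable (Function.uncurry ψ) := by
    simp only [hψ, optWeight]
    fun_prop
  have hm1 : Measurable (fun q : (Spc d × ℝ) × Spc d => η q.2 * ψ q.1.2 (q.1.1 - q.1.2 • q.2)) := by
    refine (hη.comp measurable_snd).mul ?_
    exact hψm.comp (f := fun q : (Spc d × ℝ) × Spc d => (q.1.2, q.1.1 - q.1.2 • q.2)) (by fun_prop)
  have hm2 : Measurable (fun q : Spc d × ℝ => ∫⁻ w, η w * ψ q.2 (q.1 - q.2 • w)) :=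
    hm1.lintegral_prod_right'
  calc ∫⁻ x in ball x₀ ρ, ENNReal.ofReal (g x ^ r)
      ≤ ∫⁻ x in ball x₀ ρ, (ENNReal.ofReal ((2 * (ρ ^ (1 - β) * K)) ^ r)
          + ∫⁻ s in Ioc 0 ρ, ∫⁻ w, η w * ψ s (x - s • w)) := by
        refine lintegral_mono_ae (ae_restrict_of_ae ?_)
        filter_upwards [h] with x hx
        exact rpow_le_of_forall_radius hη hη1 hβ hr1 hK hρ (hg x) ha x hx
    _ = ENNReal.ofReal ((2 * (ρ ^ (1 - β) * K)) ^ r) * volume (ball x₀ ρ)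
          + ∫⁻ x in ball x₀ ρ, ∫⁻ s in Ioc 0 ρ, ∫⁻ w, η w * ψ s (x - s • w) := by
        rw [lintegral_add_left measurable_const, setLIntegral_const]
    _ ≤ _ := by
        gcongr
        calc ∫⁻ x in ball x₀ ρ, ∫⁻ s in Ioc 0 ρ, ∫⁻ w, η w * ψ s (x - s • w)
            = ∫⁻ s in Ioc 0 ρ, ∫⁻ x in ball x₀ ρ, ∫⁻ w, η w * ψ s (x - s • w) :=
              lintegral_lintegral_swap hm2.aemeasurable
          _ = ∫⁻ s in Ioc 0 ρ, ∫⁻ w, ∫⁻ x in ball x₀ ρ, η w * ψ s (x - s • w) := by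
              refine lintegral_congr fun s => lintegral_lintegral_swap ?_
              refine Measurable.aemeasurable ?_
              exact hm1.comp (f := fun q : Spc d × Spc d => ((q.1, s), q.2)) (by fun_prop)
          _ ≤ ∫⁻ s in Ioc 0 ρ, ∫⁻ w, η w * ∫⁻ y in ball x₀ (2 * ρ), ψ s y := by
              refine setLIntegral_mono' measurableSet_Ioc fun s hs => lintegral_mono fun w => ?_
              have hψs : Measurable (ψ s) := hψm.comp measurable_prodMk_left
              have hψw : Measurable fun x => ψ s (x - s • w) :=
                hψs.comp (f := fun x => x - s • w) (by fun_prop)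
              rw [lintegral_const_mul _ hψw]
              by_cases hw : w ∈ ball (0 : Spc d) 1
              · refine mul_le_mul' le_rfl ?_
                rw [← lintegral_indicator measurableSet_ball,
                  ← lintegral_indicator measurableSet_ball]
                refine le_trans (lintegral_mono fun x => ?_)
                  (lintegral_sub_right_eq_self _ (s • w)).le
                by_cases hx : x ∈ ball x₀ ρ
                · have : x - s • w ∈ ball x₀ (2 * ρ) := by
                    rw [mem_ball_iff_norm] at hx ⊢
                    rw [mem_ball_zero_iff] at hw
                    have : ‖s • w‖ ≤ ρ := by
                      rw [norm_smul, Real.norm_of_nonneg hs.1.le]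
                      nlinarith [hs.1, hs.2, norm_nonneg w]
                    calc ‖x - s • w - x₀‖ = ‖(x - x₀) - s • w‖ := by congr 1; abel
                      _ ≤ ‖x - x₀‖ + ‖s • w‖ := norm_sub_le _ _
                      _ < 2 * ρ := by linarith
                  rw [indicator_of_mem hx, indicator_of_mem this]
                · rw [indicator_of_notMem hx]; exact zero_le
              · simp [hη0 w hw]
          _ = ∫⁻ s in Ioc 0 ρ, ∫⁻ y in ball x₀ (2 * ρ), ψ s y := by
              refine lintegral_congr fun s => ?_
              rw [lintegral_mul_const _ hη, hη1, one_mul]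
          _ = ∫⁻ y in ball x₀ (2 * ρ), ∫⁻ s in Ioc 0 ρ, ψ s y :=
              lintegral_lintegral_swap hψm.aemeasurable
          _ ≤ ∫⁻ y in ball x₀ (2 * ρ), ENNReal.ofReal (4 * 2 ^ (r - 1 + (p - 1)) *
                ((β * (p - 1) + 1) / (β * (p - 1))) * K ^ (r - p)) * ENNReal.ofReal (a y ^ p) :=
              lintegral_mono fun y => lintegral_mul_optWeight_le hp hβ hK ρ (ha0 y)
          _ = _ := lintegral_const_mul' _ _ ENNReal.ofReal_ne_top

/-- A smooth probability density supported in the open unit ball, bounded together with its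
    first derivatives by `M`. -/
structure IsKernel {d : ℕ} (η : Spc d → ℝ) (M : ℝ) : Prop where
  smooth : ContDiff ℝ (⊤ : ℕ∞) η
  nonneg : ∀ w, 0 ≤ η w
  integral_eq_one : ∫ w, η w = 1
  tsupport_subset : tsupport η ⊆ ball 0 1
  le : ∀ w, η w ≤ M
  abs_fderiv_le : ∀ w i, |fderiv ℝ η w (EuclideanSpace.single i 1)| ≤ M

/-- The unnormalized average of `f` over the parabolic cylinder of radius `ρ` at `(t,x)`,
    in rescaled variables. -/
def cylInt {d : ℕ} (f : SpT d → ℝ≥0∞) (ρ t : ℝ) (x : Spc d) : ℝ≥0∞ :=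
  ∫⁻ σ in Ioc (0 : ℝ) 1, ∫⁻ w in ball (0 : Spc d) 1, f (t + ρ ^ 2 * σ, x - ρ • w)

lemma enorm_sub_le_lintegral_of_hasDerivAt {φ φ' : ℝ → ℝ} {a b : ℝ} (hab : a ≤ b)
    (h : ∀ s, HasDerivAt φ (φ' s) s) (hc : Continuous φ') :
    ‖φ b - φ a‖ₑ ≤ ∫⁻ s in Ioc a b, ‖φ' s‖ₑ := by
  rw [← intervalIntegral.integral_eq_sub_of_hasDerivAt (fun x _ => h x)
    (hc.intervalIntegrable _ _), intervalIntegral.integral_of_le hab]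
  exact enorm_integral_le_lintegral_enorm _

lemma lintegral_enorm_mul_le {d : ℕ} {θ : Spc d → ℝ} {M : ℝ}
    (hθ : ∀ w, |θ w| ≤ M) (hs : ∀ w, w ∉ ball (0 : Spc d) 1 → θ w = 0) (g : Spc d → ℝ) :
    ∫⁻ w, ‖θ w * g w‖ₑ ≤ ENNReal.ofReal M * ∫⁻ w in ball (0 : Spc d) 1, ‖g w‖ₑ := by
  rw [← lintegral_const_mul' _ _ ENNReal.ofReal_ne_top, ← lintegral_indicator measurableSet_ball]
  refine lintegral_mono fun w => ?_
  by_cases hw : w ∈ ball (0 : Spc d) 1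
  · rw [indicator_of_mem hw, enorm_mul]
    gcongr
    rw [Real.enorm_eq_ofReal_abs]
    exact ENNReal.ofReal_le_ofReal (hθ w)
  · simp [hs w hw]

namespace IsKernel

variable {d : ℕ} {η : Spc d → ℝ} {M : ℝ}

lemma eq_zero (h : IsKernel η M) {w : Spc d} (hw : w ∉ ball (0 : Spc d) 1) : η w = 0 :=
  image_eq_zero_of_notMem_tsupport fun hw' => hw (h.tsupport_subset hw')

lemma fderiv_eq_zero (h : IsKernel η M) {w : Spc d} (hw : w ∉ ball (0 : Spc d) 1) :
    fderiv ℝ η w = 0 :=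
  image_eq_zero_of_notMem_tsupport fun hw' =>
    hw (h.tsupport_subset (tsupport_fderiv_subset ℝ hw'))

lemma hasCompactSupport (h : IsKernel η M) : HasCompactSupport η :=
  HasCompactSupport.of_support_subset_isCompact (isCompact_closedBall (0 : Spc d) 1)
    ((subset_tsupport η).trans (h.tsupport_subset.trans ball_subset_closedBall))

lemma integrable_mul (h : IsKernel η M) {g : Spc d → ℝ} (hg : Continuous g) :
    Integrable fun w => η w * g w :=
  (h.smooth.continuous.mul hg).integrable_of_hasCompactSupport h.hasCompactSupport.mul_right

lemma integrable_fderiv_mul (h : IsKernel η M) {g : Spc d → ℝ} (hg : Continuous g) (e : Spc d) :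
    Integrable fun w => fderiv ℝ η w e * g w := by
  refine Continuous.integrable_of_hasCompactSupport ?_ ?_
  · exact ((h.smooth.continuous_fderiv (by simp)).clm_apply continuous_const).mul hg
  · exact (h.hasCompactSupport.fderiv_apply (𝕜 := ℝ) e).mul_right

lemma bound_nonneg (h : IsKernel η M) : 0 ≤ M := (h.nonneg 0).trans (h.le 0)

lemma abs_le (h : IsKernel η M) (w : Spc d) : |η w| ≤ M := by
  rw [abs_of_nonneg (h.nonneg w)]; exact h.le w

lemma measurable_ofReal (h : IsKernel η M) : Measurable fun w => ENNReal.ofReal (η w) :=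
  h.smooth.continuous.measurable.ennreal_ofReal

lemma lintegral_ofReal (h : IsKernel η M) : ∫⁻ w, ENNReal.ofReal (η w) = 1 := by
  rw [← ofReal_integral_eq_lintegral_ofReal, h.integral_eq_one, ENNReal.ofReal_one]
  · simpa using h.integrable_mul (g := fun _ => 1) continuous_const
  · exact Eventually.of_forall h.nonneg

/-- Integration by parts against a rescaled kernel. -/
lemma integral_mul_fderiv (h : IsKernel η M) {W : SpT d → ℝ} (hW : ContDiff ℝ 1 W) {R : ℝ}
    (hR : 0 < R) (t : ℝ) (x : Spc d) (i : Fin d) :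
    ∫ w, η w * fderiv ℝ W (t, x - R • w) (dirS d i)
      = R⁻¹ * ∫ w, fderiv ℝ η w (EuclideanSpace.single i 1) * W (t, x - R • w) := by
  set e : Spc d := EuclideanSpace.single i 1 with he
  set g : Spc d → ℝ := fun w => W (t, x - R • w) with hg
  have hgd : ∀ w, HasFDerivAt g ((fderiv ℝ W (t, x - R • w)).comp
      (ContinuousLinearMap.prod 0 (-(R • ContinuousLinearMap.id ℝ (Spc d))))) w := by
    intro w
    have h1 : HasFDerivAt (fun w : Spc d => x - R • w) (-(R • ContinuousLinearMap.id ℝ (Spc d))) w :=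
      ((hasFDerivAt_id w).const_smul R).const_sub x
    exact ((hW.differentiable (by simp)) _).hasFDerivAt.comp w
      ((hasFDerivAt_const t w).prodMk h1)
  have hfd : ∀ w, fderiv ℝ g w e = -R * fderiv ℝ W (t, x - R • w) (dirS d i) := by
    intro w
    rw [(hgd w).fderiv]
    have : (ContinuousLinearMap.prod (0 : Spc d →L[ℝ] ℝ)
        (-(R • ContinuousLinearMap.id ℝ (Spc d)))) e = (-R) • dirS d i := by
      ext <;> simp [dirS, he]
    rw [ContinuousLinearMap.comp_apply, this, map_smul, smul_eq_mul]
  have hgc : Continuous g := hW.continuous.comp (by fun_prop)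
  have hgc' : Continuous fun w => fderiv ℝ g w e := by
    simp only [hfd]
    refine continuous_const.mul (Continuous.clm_apply ?_ continuous_const)
    exact (hW.continuous_fderiv (by simp)).comp (by fun_prop)
  have key := integral_mul_fderiv_eq_neg_fderiv_mul_of_integrable (μ := volume) (f := η) (g := g)
    (v := e) (h.integrable_fderiv_mul hgc e) (h.integrable_mul hgc') (h.integrable_mul hgc)
    (fun w _ => (h.smooth.differentiable (by simp)) w)
    (fun w _ => (hgd w).differentiableAt)
  simp only [hfd] at key
  have e1 : ∫ w, η w * (-R * fderiv ℝ W (t, x - R • w) (dirS d i))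
      = -R * ∫ w, η w * fderiv ℝ W (t, x - R • w) (dirS d i) := by
    rw [← integral_const_mul]; congr 1; ext w; ring
  rw [e1] at key
  field_simp
  linarith

end IsKernel

section SmoothEstimates

variable {d : ℕ} {η : Spc d → ℝ} {M : ℝ}

lemma hasDerivAt_parabolic_path {W : SpT d → ℝ} (hW : ContDiff ℝ 1 W) (t σ : ℝ) (x w : Spc d)
    (s : ℝ) :
    HasDerivAt (fun s : ℝ => W (t + s ^ 2 * σ, x - s • w))
      (fderiv ℝ W (t + s ^ 2 * σ, x - s • w) (2 * s * σ, -w)) s := by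
  have h1 : HasDerivAt (fun s : ℝ => t + s ^ 2 * σ) (2 * s * σ) s := by
    simpa using ((hasDerivAt_pow 2 s).mul_const σ).const_add t
  have h2 : HasDerivAt (fun s : ℝ => x - s • w) (-w) s := by
    simpa using ((hasDerivAt_id s).smul_const w).const_sub x
  exact ((hW.differentiable (by simp)) _).hasFDerivAt.comp_hasDerivAt s (h1.prodMk h2)

lemma hasDerivAt_time_path {W : SpT d → ℝ} (hW : ContDiff ℝ 1 W) (t c : ℝ) (x : Spc d)
    (s : ℝ) :
    HasDerivAt (fun s : ℝ => W (t + c * s, x))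
      (c * fderiv ℝ W (t + c * s, x) (dirT d)) s := by
  have h1 : HasDerivAt (fun s : ℝ => t + c * s) c s := by
    simpa using ((hasDerivAt_id s).const_mul c).const_add t
  have := ((hW.differentiable (by simp)) _).hasFDerivAt.comp_hasDerivAt s
    (h1.prodMk (hasDerivAt_const s x))
  have e : ((c, 0) : SpT d) = c • dirT d := by ext <;> simp [dirT]
  rw [e, map_smul, smul_eq_mul] at this
  exact this

/-- Comparison of `V` with its spatial mean at scale `R`. -/
lemma enorm_sub_spatial_mean_le (h : IsKernel η M) {V : SpT d → ℝ} (hV : ContDiff ℝ 1 V)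
    {F : SpT d → ℝ≥0∞} (hF : Measurable F)
    (hVF : ∀ z, ∀ w ∈ ball (0 : Spc d) 1, ‖fderiv ℝ V z (0, w)‖ₑ ≤ F z)
    {R : ℝ} (hR : 0 < R) (t : ℝ) (x : Spc d) :
    ‖V (t, x) - ∫ w, η w * V (t, x - R • w)‖ₑ
      ≤ truncPot (fun w => ENNReal.ofReal (η w)) R (fun y => F (t, y)) x := by
  have hc : Continuous fun w : Spc d => V (t, x - R • w) := hV.continuous.comp (by fun_prop)
  have e1 : V (t, x) - ∫ w, η w * V (t, x - R • w)
      = ∫ w, η w * (V (t, x) - V (t, x - R • w)) := by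
    simp only [mul_sub]
    rw [integral_sub (h.integrable_mul continuous_const) (h.integrable_mul hc),
      integral_mul_const, h.integral_eq_one, one_mul]
  rw [e1, truncPot]
  have hswap : ∫⁻ s in Ioc 0 R, ∫⁻ w, ENNReal.ofReal (η w) * F (t, x - s • w)
      = ∫⁻ w, ∫⁻ s in Ioc 0 R, ENNReal.ofReal (η w) * F (t, x - s • w) := by
    refine lintegral_lintegral_swap (Measurable.aemeasurable ?_)
    refine (h.measurable_ofReal.comp measurable_snd).mul ?_
    exact hF.comp (f := fun q : ℝ × Spc d => (t, x - q.1 • q.2)) (by fun_prop)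
  rw [hswap]
  refine (enorm_integral_le_lintegral_enorm _).trans (lintegral_mono fun w => ?_)
  rw [lintegral_const_mul' _ _ ENNReal.ofReal_ne_top]
  by_cases hw : w ∈ ball (0 : Spc d) 1
  · rw [enorm_mul, Real.enorm_of_nonneg (h.nonneg w)]
    gcongr
    have hd := fun s => hasDerivAt_parabolic_path hV t 0 x w s
    have hcd : Continuous fun s : ℝ =>
        fderiv ℝ V (t + s ^ 2 * 0, x - s • w) (2 * s * 0, -w) := by
      refine Continuous.clm_apply ?_ (by fun_prop)
      exact (hV.continuous_fderiv (by simp)).comp (by fun_prop)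
    have := enorm_sub_le_lintegral_of_hasDerivAt hR.le hd hcd
    simp only [mul_zero, add_zero, zero_smul, sub_zero] at this
    rw [← enorm_neg, neg_sub]
    refine this.trans (lintegral_mono fun s => ?_)
    have e2 : ((0, -w) : SpT d) = -(0, w) := by simp
    rw [e2, map_neg, enorm_neg]
    exact hVF _ w hw
  · simp [h.eq_zero hw]

/-- Comparison of two spatial means at the same scale and different times. -/
lemma enorm_spatial_mean_sub_le (h : IsKernel η M) {U : SpT d → ℝ} (hU : ContDiff ℝ 1 U)
    {G : SpT d → ℝ≥0∞} (hG : Measurable G)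
    (hUG : ∀ z, ‖fderiv ℝ U z (dirT d)‖ₑ ≤ G z) (i : Fin d)
    {R : ℝ} (hR : 0 < R) (t : ℝ) (x : Spc d) {σ : ℝ} (hσ : σ ∈ Ioc (0 : ℝ) 1) :
    ‖(∫ w, η w * fderiv ℝ U (t, x - R • w) (dirS d i))
        - ∫ w, η w * fderiv ℝ U (t + R ^ 2 * σ, x - R • w) (dirS d i)‖ₑ
      ≤ ENNReal.ofReal (R * M) * cylInt G R t x := by
  have hc : ∀ t, Continuous fun w : Spc d => U (t, x - R • w) :=
    fun t => hU.continuous.comp (by fun_prop)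
  rw [h.integral_mul_fderiv hU hR, h.integral_mul_fderiv hU hR, ← mul_sub,
    ← integral_sub (h.integrable_fderiv_mul (hc _) _) (h.integrable_fderiv_mul (hc _) _)]
  simp only [← mul_sub]
  rw [enorm_mul, Real.enorm_of_nonneg (by positivity : 0 ≤ R⁻¹)]
  have hsw : cylInt G R t x = ∫⁻ w in ball (0 : Spc d) 1, ∫⁻ τ in Ioc (0 : ℝ) 1,
      G (t + R ^ 2 * τ, x - R • w) := by
    refine lintegral_lintegral_swap (Measurable.aemeasurable ?_)
    exact hG.comp (f := fun q : ℝ × Spc d => (t + R ^ 2 * q.1, x - R • q.2)) (by fun_prop)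
  calc ENNReal.ofReal R⁻¹ * ‖∫ w, fderiv ℝ η w (EuclideanSpace.single i 1) *
          (U (t, x - R • w) - U (t + R ^ 2 * σ, x - R • w))‖ₑ
      ≤ ENNReal.ofReal R⁻¹ * (ENNReal.ofReal M * ∫⁻ w in ball (0 : Spc d) 1,
          ‖U (t, x - R • w) - U (t + R ^ 2 * σ, x - R • w)‖ₑ) := by
        gcongr
        refine (enorm_integral_le_lintegral_enorm _).trans ?_
        exact lintegral_enorm_mul_le (fun w => h.abs_fderiv_le w i)
          (fun w hw => by rw [h.fderiv_eq_zero hw]; rfl) _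
    _ ≤ ENNReal.ofReal R⁻¹ * (ENNReal.ofReal M * ∫⁻ w in ball (0 : Spc d) 1,
          ENNReal.ofReal (R ^ 2) * ∫⁻ τ in Ioc (0 : ℝ) 1, G (t + R ^ 2 * τ, x - R • w)) := by
        gcongr with w
        have hcd : Continuous fun s : ℝ =>
            R ^ 2 * fderiv ℝ U (t + R ^ 2 * s, x - R • w) (dirT d) := by
          refine continuous_const.mul (Continuous.clm_apply ?_ continuous_const)
          exact (hU.continuous_fderiv (by simp)).comp (by fun_prop)
        have := enorm_sub_le_lintegral_of_hasDerivAt hσ.1.le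
          (fun s => hasDerivAt_time_path hU t (R ^ 2) (x - R • w) s) hcd
        simp only [mul_zero, add_zero] at this
        rw [← enorm_neg, neg_sub]
        refine this.trans ((lintegral_mono_set (Ioc_subset_Ioc_right hσ.2)).trans ?_)
        rw [← lintegral_const_mul' _ _ ENNReal.ofReal_ne_top]
        refine lintegral_mono fun s => ?_
        rw [enorm_mul, Real.enorm_of_nonneg (by positivity)]
        gcongr
        exact hUG _
    _ = ENNReal.ofReal (R * M) * cylInt G R t x := by
        rw [lintegral_const_mul' _ _ ENNReal.ofReal_ne_top, ← hsw, ← mul_assoc, ← mul_assoc,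
          ← ENNReal.ofReal_mul (by positivity),
          ← ENNReal.ofReal_mul (mul_nonneg (by positivity) h.bound_nonneg)]
        congr 2
        field_simp

/-- Comparison of two spatial means along a parabolic path. -/
lemma enorm_parabolic_mean_sub_le (h : IsKernel η M) {V W : SpT d → ℝ} (hV : ContDiff ℝ 1 V)
    (hW : ContDiff ℝ 1 W) (i : Fin d)
    (hVW : ∀ z, fderiv ℝ V z (dirT d) = fderiv ℝ W z (dirS d i))
    {F G : SpT d → ℝ≥0∞} (hG : Measurable G)
    (hVF : ∀ z, ∀ w ∈ ball (0 : Spc d) 1, ‖fderiv ℝ V z (0, w)‖ₑ ≤ F z)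
    (hWG : ∀ z, ‖W z‖ₑ ≤ G z)
    {R : ℝ} (hR : 0 < R) (hR1 : R ≤ 1) (t : ℝ) (x : Spc d) {σ : ℝ} (hσ : σ ∈ Ioc (0 : ℝ) 1) :
    ‖(∫ w, η w * V (t + σ, x - w)) - ∫ w, η w * V (t + R ^ 2 * σ, x - R • w)‖ₑ
      ≤ ∫⁻ ρ in Ioc R 1, ∫⁻ w in ball (0 : Spc d) 1,
          ENNReal.ofReal (2 * M) * G (t + ρ ^ 2 * σ, x - ρ • w)
            + ENNReal.ofReal M * F (t + ρ ^ 2 * σ, x - ρ • w) := by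
  have hVc := hV.continuous_fderiv (by simp)
  have hpath : ∀ w : Spc d, V (t + σ, x - w) - V (t + R ^ 2 * σ, x - R • w)
      = ∫ ρ in Ioc R 1, fderiv ℝ V (t + ρ ^ 2 * σ, x - ρ • w) (2 * ρ * σ, -w) := by
    intro w
    rw [← intervalIntegral.integral_of_le hR1,
      intervalIntegral.integral_eq_sub_of_hasDerivAt
        (fun s _ => hasDerivAt_parabolic_path hV t σ x w s)]
    · simp
    · refine Continuous.intervalIntegrable (Continuous.clm_apply ?_ (by fun_prop)) _ _
      exact hVc.comp (by fun_prop)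
  have hc : ∀ (c ρ : ℝ), Continuous fun w : Spc d => V (t + c, x - ρ • w) :=
    fun c ρ => hV.continuous.comp (by fun_prop)
  have hc1 := hc σ 1
  simp only [one_smul] at hc1
  rw [← integral_sub (h.integrable_mul hc1) (h.integrable_mul (hc _ _))]
  simp only [← mul_sub, hpath, ← integral_const_mul]
  have hint : Integrable (Function.uncurry fun (w : Spc d) (ρ : ℝ) =>
      η w * fderiv ℝ V (t + ρ ^ 2 * σ, x - ρ • w) (2 * ρ * σ, -w))
      ((volume : Measure (Spc d)).prod (volume.restrict (Ioc R 1))) := by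
    have hcont : Continuous (Function.uncurry fun (w : Spc d) (ρ : ℝ) =>
        η w * fderiv ℝ V (t + ρ ^ 2 * σ, x - ρ • w) (2 * ρ * σ, -w)) := by
      refine (h.smooth.continuous.comp continuous_fst).mul (Continuous.clm_apply ?_ (by fun_prop))
      exact hVc.comp (f := fun q : Spc d × ℝ => (t + q.2 ^ 2 * σ, x - q.2 • q.1)) (by fun_prop)
    have hcomp : IsCompact (closedBall (0 : Spc d) 1 ×ˢ Icc R 1) :=
      (isCompact_closedBall _ _).prod isCompact_Icc
    have h1 : IntegrableOn _ _ ((volume : Measure (Spc d)).prod (volume : Measure ℝ)) :=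
      hcont.continuousOn.integrableOn_compact hcomp
    have h2 := h1.of_forall_sdiff_eq_zero (t := univ ×ˢ Ioc R 1)
      (MeasurableSet.univ.prod measurableSet_Ioc) (fun q hq => by
        have : q.1 ∉ ball (0 : Spc d) 1 := fun hq1 =>
          hq.2 ⟨ball_subset_closedBall hq1, Ioc_subset_Icc_self hq.1.2⟩
        simp [Function.uncurry, h.eq_zero this])
    rwa [IntegrableOn, ← Measure.prod_restrict, Measure.restrict_univ] at h2
  rw [integral_integral_swap hint]
  refine (enorm_integral_le_lintegral_enorm _).trans ?_
  refine setLIntegral_mono' measurableSet_Ioc fun ρ hρ => ?_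
  have hρ0 : 0 < ρ := hR.trans hρ.1
  have hsplit : ∀ w : Spc d, η w * fderiv ℝ V (t + ρ ^ 2 * σ, x - ρ • w) (2 * ρ * σ, -w)
      = (2 * ρ * σ) * (η w * fderiv ℝ W (t + ρ ^ 2 * σ, x - ρ • w) (dirS d i))
        - η w * fderiv ℝ V (t + ρ ^ 2 * σ, x - ρ • w) (0, w) := by
    intro w
    have e : ((2 * ρ * σ, -w) : SpT d) = (2 * ρ * σ) • dirT d - (0, w) := by
      ext <;> simp [dirT]
    rw [e, map_sub, map_smul, hVW, smul_eq_mul]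
    ring
  have hcW : Continuous fun w : Spc d => W (t + ρ ^ 2 * σ, x - ρ • w) :=
    hW.continuous.comp (by fun_prop)
  have hcW' : Continuous fun w : Spc d => fderiv ℝ W (t + ρ ^ 2 * σ, x - ρ • w) (dirS d i) :=
    Continuous.clm_apply ((hW.continuous_fderiv (by simp)).comp (by fun_prop)) continuous_const
  have hcV' : Continuous fun w : Spc d => fderiv ℝ V (t + ρ ^ 2 * σ, x - ρ • w) (0, w) :=
    Continuous.clm_apply (hVc.comp (by fun_prop)) (by fun_prop)
  simp only [hsplit]
  rw [integral_sub ((h.integrable_mul hcW').const_mul _) (h.integrable_mul hcV'),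
    integral_const_mul, h.integral_mul_fderiv hW hρ0, lintegral_add_left]
  · refine enorm_sub_le.trans (add_le_add ?_ ?_)
    · have e2M : ENNReal.ofReal (2 * M) = ENNReal.ofReal 2 * ENNReal.ofReal M :=
        ENNReal.ofReal_mul (by norm_num)
      rw [← mul_assoc, enorm_mul, lintegral_const_mul' _ _ ENNReal.ofReal_ne_top,
        show 2 * ρ * σ * ρ⁻¹ = 2 * σ by field_simp,
        Real.enorm_of_nonneg (by linarith [hσ.1]), e2M, mul_assoc]
      calc ENNReal.ofReal (2 * σ) * ‖∫ w, fderiv ℝ η w (EuclideanSpace.single i 1) *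
              W (t + ρ ^ 2 * σ, x - ρ • w)‖ₑ
          ≤ ENNReal.ofReal 2 * (ENNReal.ofReal M * ∫⁻ w in ball (0 : Spc d) 1,
              ‖W (t + ρ ^ 2 * σ, x - ρ • w)‖ₑ) := by
            gcongr
            · linarith [hσ.2]
            · refine (enorm_integral_le_lintegral_enorm _).trans ?_
              exact lintegral_enorm_mul_le (fun w => h.abs_fderiv_le w i)
                (fun w hw => by rw [h.fderiv_eq_zero hw]; rfl) _
        _ ≤ _ := by gcongr; exact hWG _
    · refine (enorm_integral_le_lintegral_enorm _).trans ?_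
      rw [lintegral_const_mul' _ _ ENNReal.ofReal_ne_top]
      refine (lintegral_enorm_mul_le h.abs_le (fun w hw => h.eq_zero hw) _).trans ?_
      exact mul_le_mul' le_rfl (setLIntegral_mono' measurableSet_ball fun w hw => hVF _ w hw)
  · refine Measurable.const_mul ?_ _
    exact hG.comp (f := fun w : Spc d => (t + ρ ^ 2 * σ, x - ρ • w)) (by fun_prop)

lemma lintegral_Ioc_rpow_neg_le {β R : ℝ} (hβ : 1 < β) (hR : 0 < R) :
    ∫⁻ ρ in Ioc R 1, ENNReal.ofReal (ρ ^ (-β)) ≤ ENNReal.ofReal (R ^ (1 - β) / (β - 1)) := by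
  have h1 := integrableOn_Ioi_rpow_of_lt (by linarith : -β < -1) hR
  have h2 := integral_Ioi_rpow_of_lt (by linarith : -β < -1) hR
  calc ∫⁻ ρ in Ioc R 1, ENNReal.ofReal (ρ ^ (-β))
      ≤ ∫⁻ ρ in Ioi R, ENNReal.ofReal (ρ ^ (-β)) := lintegral_mono_set Ioc_subset_Ioi_self
    _ = ENNReal.ofReal (∫ ρ in Ioi R, ρ ^ (-β)) := by
        rw [ofReal_integral_eq_lintegral_ofReal h1]
        refine (ae_restrict_iff' measurableSet_Ioi).2 (Eventually.of_forall fun ρ hρ => ?_)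
        exact Real.rpow_nonneg (hR.trans (mem_Ioi.1 hρ)).le _
    _ = ENNReal.ofReal (R ^ (1 - β) / (β - 1)) := by
        rw [h2]
        congr 1
        rw [show -β + 1 = -(β - 1) by ring, neg_div_neg_eq, neg_sub]

/-- Pointwise control of the gradient of a smooth function by a truncated potential of the
    Hessian, when the Hessian, the time derivative and the gradient have cylinder averages of
    order `ρ ^ (-β)`. -/
lemma enorm_fderiv_le_truncPot_add (h : IsKernel η M) {U : SpT d → ℝ}
    (hU : ContDiff ℝ (⊤ : ℕ∞) U) (i : Fin d) {F G P : SpT d → ℝ≥0∞} (hF : Measurable F)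
    (hG : Measurable G)
    (hUF : ∀ z, ∀ w ∈ ball (0 : Spc d) 1,
      ‖fderiv ℝ (fun z => fderiv ℝ U z (dirS d i)) z (0, w)‖ₑ ≤ F z)
    (hUG : ∀ z, ‖fderiv ℝ U z (dirT d)‖ₑ ≤ G z)
    (hUP : ∀ z, ‖fderiv ℝ U z (dirS d i)‖ₑ ≤ P z) {β A : ℝ} (hβ : 1 < β) (hA : 0 ≤ A)
    (hcF : ∀ ρ t x, 0 < ρ → ρ ≤ 1 → cylInt F ρ t x ≤ ENNReal.ofReal (A * ρ ^ (-β)))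
    (hcG : ∀ ρ t x, 0 < ρ → ρ ≤ 1 → cylInt G ρ t x ≤ ENNReal.ofReal (A * ρ ^ (-β)))
    (hcP : ∀ ρ t x, 0 < ρ → ρ ≤ 1 → cylInt P ρ t x ≤ ENNReal.ofReal (A * ρ ^ (-β)))
    {R : ℝ} (hR : 0 < R) (hR1 : R ≤ 1) (t : ℝ) (x : Spc d) :
    ‖fderiv ℝ U (t, x) (dirS d i)‖ₑ
      ≤ truncPot (fun w => ENNReal.ofReal (η w)) R (fun y => F (t, y)) x
        + ENNReal.ofReal (M * (2 + 3 / (β - 1)) * A * R ^ (1 - β)) := by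
  have hM := h.bound_nonneg
  have hsm : ∀ e, ContDiff ℝ (⊤ : ℕ∞) fun z => fderiv ℝ U z e := fun e =>
    (hU.fderiv_right (m := (⊤ : ℕ∞)) (by simp)).clm_apply contDiff_const
  have h1 : ∀ {W : SpT d → ℝ}, ContDiff ℝ (⊤ : ℕ∞) W → ContDiff ℝ 1 W := fun hW =>
    hW.of_le (by exact_mod_cast le_top)
  have hsymm : ∀ z, fderiv ℝ (fun z => fderiv ℝ U z (dirS d i)) z (dirT d)
      = fderiv ℝ (fun z => fderiv ℝ U z (dirT d)) z (dirS d i) := by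
    intro z
    have hd : DifferentiableAt ℝ (fderiv ℝ U) z :=
      ((hU.fderiv_right (m := (⊤ : ℕ∞)) (by simp)).differentiable (by simp)) z
    have hs : IsSymmSndFDerivAt ℝ U z :=
      (hU.contDiffAt).isSymmSndFDerivAt
        (by simpa using WithTop.coe_le_coe.2 (le_top : (2 : ℕ∞) ≤ ⊤))
    rw [fderiv_clm_apply hd (differentiableAt_const _),
      fderiv_clm_apply hd (differentiableAt_const _)]
    simpa using hs (dirT d) (dirS d i)
  set V : SpT d → ℝ := fun z => fderiv ℝ U z (dirS d i) with hV
  set L : ℝ → ℝ≥0∞ := fun σ => ∫⁻ ρ in Ioc R 1, ∫⁻ w in ball (0 : Spc d) 1,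
      (ENNReal.ofReal (2 * M) * G (t + ρ ^ 2 * σ, x - ρ • w)
        + ENNReal.ofReal M * F (t + ρ ^ 2 * σ, x - ρ • w)) with hL
  set Q : ℝ → ℝ≥0∞ := fun σ => ∫⁻ w in ball (0 : Spc d) 1, P (t + σ, x - w) with hQ
  have hpt : ∀ σ ∈ Ioc (0 : ℝ) 1, ‖V (t, x)‖ₑ
      ≤ (truncPot (fun w => ENNReal.ofReal (η w)) R (fun y => F (t, y)) x
        + ENNReal.ofReal (R * M) * cylInt G R t x + L σ) + ENNReal.ofReal M * Q σ := by
    intro σ hσ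
    have l1 := enorm_sub_spatial_mean_le h (h1 (hsm (dirS d i))) hF hUF hR t x
    have l2 := enorm_spatial_mean_sub_le h (h1 hU) hG hUG i hR t x hσ
    have l3 := enorm_parabolic_mean_sub_le h (h1 (hsm (dirS d i))) (h1 (hsm (dirT d))) i hsymm
      hG hUF hUG hR hR1 t x hσ
    have l4 : ‖∫ w, η w * V (t + σ, x - w)‖ₑ ≤ ENNReal.ofReal M * Q σ := by
      refine (enorm_integral_le_lintegral_enorm _).trans ?_
      refine (lintegral_enorm_mul_le h.abs_le (fun w hw => h.eq_zero hw) _).trans ?_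
      exact mul_le_mul' le_rfl (lintegral_mono fun w => hUP _)
    rw [← enorm_neg, neg_sub] at l3
    set a := V (t, x)
    set b := ∫ w, η w * V (t, x - R • w)
    set c := ∫ w, η w * V (t + R ^ 2 * σ, x - R • w)
    set e := ∫ w, η w * V (t + σ, x - w)
    calc ‖a‖ₑ = ‖(a - b) + (b - c) + (c - e) + e‖ₑ := by congr 1; ring
      _ ≤ ‖a - b‖ₑ + ‖b - c‖ₑ + ‖c - e‖ₑ + ‖e‖ₑ := by
          refine (enorm_add_le _ _).trans (add_le_add ?_ le_rfl)
          refine (enorm_add_le _ _).trans (add_le_add ?_ le_rfl)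
          exact enorm_add_le _ _
      _ ≤ _ := add_le_add (add_le_add (add_le_add l1 l2) l3) l4
  have hmeas : Measurable fun q : (ℝ × ℝ) × Spc d =>
      ENNReal.ofReal (2 * M) * G (t + q.1.2 ^ 2 * q.1.1, x - q.1.2 • q.2)
        + ENNReal.ofReal M * F (t + q.1.2 ^ 2 * q.1.1, x - q.1.2 • q.2) := by
    have hp : Measurable fun q : (ℝ × ℝ) × Spc d =>
        ((t + q.1.2 ^ 2 * q.1.1, x - q.1.2 • q.2) : SpT d) := by fun_prop
    exact ((hG.comp hp).const_mul _).add ((hF.comp hp).const_mul _)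
  have hmeas2 := hmeas.lintegral_prod_right' (ν := volume.restrict (ball (0 : Spc d) 1))
  have hLm : Measurable L := hmeas2.lintegral_prod_right' (ν := volume.restrict (Ioc R 1))
  have hL1 : ∫⁻ σ in Ioc (0 : ℝ) 1, L σ
      ≤ ENNReal.ofReal (3 * M * A * (R ^ (1 - β) / (β - 1))) := by
    rw [hL, lintegral_lintegral_swap hmeas2.aemeasurable]
    calc ∫⁻ ρ in Ioc R 1, ∫⁻ σ in Ioc (0 : ℝ) 1, ∫⁻ w in ball (0 : Spc d) 1,
          (ENNReal.ofReal (2 * M) * G (t + ρ ^ 2 * σ, x - ρ • w)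
            + ENNReal.ofReal M * F (t + ρ ^ 2 * σ, x - ρ • w))
        = ∫⁻ ρ in Ioc R 1, (ENNReal.ofReal (2 * M) * cylInt G ρ t x
            + ENNReal.ofReal M * cylInt F ρ t x) := by
          refine lintegral_congr fun ρ => ?_
          have hp : Measurable fun q : ℝ × Spc d =>
            ((t + ρ ^ 2 * q.1, x - ρ • q.2) : SpT d) := by fun_prop
          have hGp : Measurable fun q : ℝ × Spc d =>
            ENNReal.ofReal (2 * M) * G (t + ρ ^ 2 * q.1, x - ρ • q.2) :=
            (hG.comp hp).const_mul _
          rw [cylInt, cylInt, ← lintegral_const_mul' _ _ ENNReal.ofReal_ne_top,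
            ← lintegral_const_mul' _ _ ENNReal.ofReal_ne_top, ← lintegral_add_left]
          · refine lintegral_congr fun σ => ?_
            rw [lintegral_add_left, lintegral_const_mul' _ _ ENNReal.ofReal_ne_top,
              lintegral_const_mul' _ _ ENNReal.ofReal_ne_top]
            exact hGp.comp measurable_prodMk_left
          · refine Measurable.const_mul ?_ _
            exact (hG.comp hp).lintegral_prod_right' (ν := volume.restrict (ball (0 : Spc d) 1))
      _ ≤ ∫⁻ ρ in Ioc R 1, ENNReal.ofReal (3 * M * A) * ENNReal.ofReal (ρ ^ (-β)) := by
          refine setLIntegral_mono' measurableSet_Ioc fun ρ hρ => ?_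
          have hρ0 : 0 < ρ := hR.trans hρ.1
          have hρp : 0 ≤ ρ ^ (-β) := Real.rpow_nonneg hρ0.le _
          refine (add_le_add (mul_le_mul' le_rfl (hcG ρ t x hρ0 hρ.2))
            (mul_le_mul' le_rfl (hcF ρ t x hρ0 hρ.2))).trans (le_of_eq ?_)
          rw [← ENNReal.ofReal_mul (by positivity), ← ENNReal.ofReal_mul hM,
            ← ENNReal.ofReal_mul (by positivity), ← ENNReal.ofReal_add (by positivity)
              (by positivity)]
          congr 1
          ring
      _ ≤ _ := by
          rw [lintegral_const_mul' _ _ ENNReal.ofReal_ne_top, ENNReal.ofReal_mul (by positivity : 0 ≤ 3 * M * A)]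
          exact mul_le_mul' le_rfl (lintegral_Ioc_rpow_neg_le hβ hR)
  have hQ1 : ∫⁻ σ in Ioc (0 : ℝ) 1, Q σ ≤ ENNReal.ofReal A := by
    have := hcP 1 t x one_pos le_rfl
    simpa [cylInt] using this
  have hRp : 1 ≤ R ^ (1 - β) := Real.one_le_rpow_of_pos_of_le_one_of_nonpos hR hR1 (by linarith)
  have hR0 : 0 ≤ R ^ (1 - β) := by linarith
  have hβ0 : 0 ≤ (β - 1)⁻¹ := inv_nonneg.2 (by linarith)
  calc ‖V (t, x)‖ₑ = ∫⁻ _ in Ioc (0 : ℝ) 1, ‖V (t, x)‖ₑ := by simp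
    _ ≤ ∫⁻ σ in Ioc (0 : ℝ) 1,
        ((truncPot (fun w => ENNReal.ofReal (η w)) R (fun y => F (t, y)) x
          + ENNReal.ofReal (R * M) * cylInt G R t x + L σ) + ENNReal.ofReal M * Q σ) :=
        setLIntegral_mono' measurableSet_Ioc hpt
    _ = truncPot (fun w => ENNReal.ofReal (η w)) R (fun y => F (t, y)) x
          + ENNReal.ofReal (R * M) * cylInt G R t x + (∫⁻ σ in Ioc (0 : ℝ) 1, L σ)
          + ENNReal.ofReal M * ∫⁻ σ in Ioc (0 : ℝ) 1, Q σ := by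
        have hcLm : Measurable fun σ =>
            truncPot (fun w => ENNReal.ofReal (η w)) R (fun y => F (t, y)) x
              + ENNReal.ofReal (R * M) * cylInt G R t x + L σ := measurable_const.add hLm
        rw [lintegral_add_left hcLm,
          lintegral_const_mul' _ _ ENNReal.ofReal_ne_top, lintegral_add_left measurable_const]
        simp
    _ ≤ truncPot (fun w => ENNReal.ofReal (η w)) R (fun y => F (t, y)) x
          + ENNReal.ofReal (R * M) * ENNReal.ofReal (A * R ^ (-β))
          + ENNReal.ofReal (3 * M * A * (R ^ (1 - β) / (β - 1)))
          + ENNReal.ofReal M * ENNReal.ofReal A := by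
        gcongr
        exact hcG R t x hR hR1
    _ ≤ _ := by
        have hRn : 0 ≤ R ^ (-β) := Real.rpow_nonneg hR.le _
        have hdiv : 0 ≤ R ^ (1 - β) / (β - 1) := div_nonneg hR0 (by linarith)
        rw [← ENNReal.ofReal_mul (by positivity), ← ENNReal.ofReal_mul hM, add_assoc, add_assoc,
          ← ENNReal.ofReal_add (by positivity) (by positivity),
          ← ENNReal.ofReal_add (by positivity) (by positivity)]
        refine add_le_add le_rfl (ENNReal.ofReal_le_ofReal ?_)
        have e1 : R * M * (A * R ^ (-β)) = M * A * R ^ (1 - β) := by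
          rw [sub_eq_add_neg, Real.rpow_add hR, Real.rpow_one]; ring
        rw [e1]
        have e2 : M * A ≤ M * A * R ^ (1 - β) :=
          le_mul_of_one_le_right (mul_nonneg hM hA) hRp
        have e3 : M * (2 + 3 / (β - 1)) * A * R ^ (1 - β)
            = M * A * R ^ (1 - β) + (3 * M * A * (R ^ (1 - β) / (β - 1)) + M * A * R ^ (1 - β)) := by
          ring
        linarith

end SmoothEstimates

section ChangeOfVariables

lemma lintegral_comp_const_smul {E : Type*} [NormedAddCommGroup E] [NormedSpace ℝ E]
    [FiniteDimensional ℝ E] [MeasurableSpace E] [BorelSpace E] (μ : Measure E)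
    [μ.IsAddHaarMeasure] {f : E → ℝ≥0∞} (hf : Measurable f) {r : ℝ} (hr : r ≠ 0) :
    ∫⁻ w, f (r • w) ∂μ = ENNReal.ofReal |(r ^ Module.finrank ℝ E)⁻¹| * ∫⁻ y, f y ∂μ := by
  rw [← lintegral_map (g := fun w => r • w) hf (measurable_const_smul r),
    Measure.map_addHaar_smul μ hr, lintegral_smul_measure, smul_eq_mul]

lemma lintegral_ball_rescale {d : ℕ} {f : Spc d → ℝ≥0∞} (hf : Measurable f) {ρ : ℝ} (hρ : 0 < ρ)
    (x : Spc d) :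
    ∫⁻ w in ball (0 : Spc d) 1, f (x - ρ • w)
      = volume (ball (0 : Spc d) 1) * ((∫⁻ y in ball x ρ, f y) / volume (ball x ρ)) := by
  have hρd : 0 < ρ ^ Module.finrank ℝ (Spc d) := by positivity
  have hfm : Measurable fun y => (ball x ρ).indicator f (x - y) :=
    (hf.indicator measurableSet_ball).comp (measurable_const.sub measurable_id)
  rw [← lintegral_indicator measurableSet_ball, ← lintegral_indicator measurableSet_ball]
  have e1 : ∀ w : Spc d, (ball (0 : Spc d) 1).indicator (fun w => f (x - ρ • w)) w
      = (fun y => (ball x ρ).indicator f (x - y)) (ρ • w) := by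
    intro w
    simp only [indicator, mem_ball, dist_eq_norm, sub_zero, sub_sub_cancel_left, norm_neg,
      norm_smul, Real.norm_of_nonneg hρ.le]
    congr 1
    rw [mul_lt_iff_lt_one_right hρ]
  simp_rw [e1]
  rw [lintegral_comp_const_smul volume hfm hρ.ne', lintegral_sub_left_eq_self,
    Measure.addHaar_ball_of_pos volume x hρ, abs_of_pos (by positivity), div_eq_mul_inv,
    ENNReal.ofReal_inv_of_pos hρd, ENNReal.mul_inv (Or.inr measure_ball_lt_top.ne)
      (Or.inl ENNReal.ofReal_ne_top)]
  have hv : volume (ball (0 : Spc d) 1) * (volume (ball (0 : Spc d) 1))⁻¹ = 1 :=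
    ENNReal.mul_inv_cancel (measure_ball_pos _ _ one_pos).ne' measure_ball_lt_top.ne
  set I := ∫⁻ y, (ball x ρ).indicator f y
  calc _ = (volume (ball (0 : Spc d) 1) * (volume (ball (0 : Spc d) 1))⁻¹) *
        ((ENNReal.ofReal (ρ ^ Module.finrank ℝ (Spc d)))⁻¹ * I) := by rw [hv, one_mul]
    _ = _ := by ring

lemma lintegral_Ioc_rescale {f : ℝ → ℝ≥0∞} (hf : Measurable f) {c : ℝ} (hc : 0 < c) (t : ℝ) :
    ∫⁻ σ in Ioc (0 : ℝ) 1, f (t + c * σ) = (∫⁻ τ in Ico t (t + c), f τ) / ENNReal.ofReal c := by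
  have hfm : Measurable fun y => (Ioc t (t + c)).indicator f (t + y) :=
    (hf.indicator measurableSet_Ioc).comp (measurable_const.add measurable_id)
  rw [setLIntegral_congr (Ico_ae_eq_Ioc (μ := volume) (a := t) (b := t + c)),
    ← lintegral_indicator measurableSet_Ioc, ← lintegral_indicator measurableSet_Ioc]
  have e1 : ∀ w : ℝ, (Ioc (0 : ℝ) 1).indicator (fun w => f (t + c * w)) w
      = (fun y => (Ioc t (t + c)).indicator f (t + y)) (c • w) := by
    intro w
    have : t + c • w ∈ Ioc t (t + c) ↔ w ∈ Ioc (0 : ℝ) 1 := by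
      simp [hc, mul_le_iff_le_one_right]
    simp only [indicator, this]
    rfl
  simp_rw [e1]
  rw [lintegral_comp_const_smul volume hfm hc.ne', lintegral_add_left_eq_self]
  simp only [Module.finrank_self, pow_one]
  rw [abs_of_pos (by positivity), ENNReal.ofReal_inv_of_pos hc, div_eq_mul_inv, mul_comm]

lemma cylInt_eq {d : ℕ} {f : SpT d → ℝ≥0∞} (hf : Measurable f) {ρ : ℝ} (hρ : 0 < ρ) (t : ℝ)
    (x : Spc d) :
    cylInt f ρ t x = volume (ball (0 : Spc d) 1) *
      ((∫⁻ τ in Ico t (t + ρ ^ 2), (∫⁻ y in ball x ρ, f (τ, y)) / volume (ball x ρ))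
        / ENNReal.ofReal (ρ ^ 2)) := by
  have hm : Measurable fun τ => (∫⁻ y in ball x ρ, f (τ, y)) / volume (ball x ρ) :=
    (hf.lintegral_prod_right' (ν := volume.restrict (ball x ρ))).div_const _
  rw [← lintegral_Ioc_rescale hm (by positivity), cylInt,
    ← lintegral_const_mul' _ _ measure_ball_lt_top.ne]
  refine lintegral_congr fun σ => ?_
  exact lintegral_ball_rescale (hf.comp measurable_prodMk_left) hρ x

lemma setLIntegral_cylinder_one {d : ℕ} {f : SpT d → ℝ≥0∞} (hf : Measurable f) (t : ℝ)
    (x : Spc d) :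
    ∫⁻ z in Ico t (t + 1) ×ˢ ball x 1, f z = cylInt f 1 t x := by
  rw [cylInt_eq hf one_pos, Measure.volume_eq_prod, ← Measure.prod_restrict,
    lintegral_prod _ hf.aemeasurable]
  have hv : volume (ball x 1) = volume (ball (0 : Spc d) 1) := Measure.addHaar_ball_center _ _ _
  simp only [one_pow, ENNReal.ofReal_one, div_eq_mul_inv, inv_one, mul_one]
  rw [lintegral_mul_const' _ _ (by simp [hv, (measure_ball_pos volume (0 : Spc d) one_pos).ne']),
    hv, mul_left_comm, ENNReal.mul_inv_cancel
      (measure_ball_pos _ _ one_pos).ne' measure_ball_lt_top.ne, mul_one]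

lemma locallyIntegrable_of_cylInt_le {d : ℕ} {v : SpT d → ℝ} (hv : AEStronglyMeasurable v)
    {f : SpT d → ℝ≥0∞} (hf : Measurable f) (hvf : ∀ᵐ z, ‖v z‖ₑ ≤ f z) {B : ℝ≥0∞} (hB : B ≠ ⊤)
    (hc : ∀ t x, cylInt f 1 t x ≤ B) : LocallyIntegrable v := by
  intro z
  refine ⟨Ico (z.1 - 1 / 2) (z.1 - 1 / 2 + 1) ×ˢ ball z.2 1, ?_, hv.restrict, ?_⟩
  · rw [show z = (z.1, z.2) from rfl]
    exact prod_mem_nhds (Ico_mem_nhds (by simp) (by dsimp; linarith)) (ball_mem_nhds _ one_pos)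
  · refine lt_of_le_of_lt (lintegral_mono_ae (ae_restrict_of_ae hvf)) ?_
    rw [setLIntegral_cylinder_one hf]
    exact (hc _ _).trans_lt hB.lt_top

end ChangeOfVariables

section Smearing

variable {d : ℕ}

/-- Convolution of nonnegative functions on space-time. -/
def smear (k f : SpT d → ℝ≥0∞) (z : SpT d) : ℝ≥0∞ := ∫⁻ y, k y * f (z - y)

lemma measurable_smear {k f : SpT d → ℝ≥0∞} (hk : Measurable k) (hf : Measurable f) :
    Measurable (smear k f) := by
  refine Measurable.lintegral_prod_right' (f := fun q : SpT d × SpT d => k q.2 * f (q.1 - q.2)) ?_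
  exact (hk.comp measurable_snd).mul (hf.comp (measurable_fst.sub measurable_snd))

lemma cylInt_smear {k f : SpT d → ℝ≥0∞} (hk : Measurable k) (hf : Measurable f)
    (ρ t : ℝ) (x : Spc d) :
    cylInt (smear k f) ρ t x = ∫⁻ y, k y * cylInt f ρ (t - y.1) (x - y.2) := by
  have hm : Measurable fun q : (ℝ × Spc d) × SpT d =>
      k q.2 * f ((t + ρ ^ 2 * q.1.1, x - ρ • q.1.2) - q.2) := by
    refine (hk.comp measurable_snd).mul (hf.comp ?_)
    fun_prop
  have hm1 : ∀ g : SpT d → ℝ≥0∞, Measurable g → ∀ (t : ℝ) (x : Spc d), cylInt g ρ t x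
      = ∫⁻ q : ℝ × Spc d, g (t + ρ ^ 2 * q.1, x - ρ • q.2)
          ∂((volume.restrict (Ioc 0 1)).prod (volume.restrict (ball 0 1))) := by
    intro g hg t x
    rw [lintegral_prod]
    · rfl
    · exact (hg.comp (f := fun q : ℝ × Spc d => ((t + ρ ^ 2 * q.1, x - ρ • q.2) : SpT d))
        (by fun_prop)).aemeasurable
  rw [hm1 _ (measurable_smear hk hf)]
  unfold smear
  rw [lintegral_lintegral_swap hm.aemeasurable]
  refine lintegral_congr fun y => ?_
  rw [hm1 _ hf, ← lintegral_const_mul]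
  · refine lintegral_congr fun q => ?_
    congr 2
    ext1
    · simp; ring
    · simp; abel
  · exact hf.comp (f := fun q : ℝ × Spc d => ((t - y.1 + ρ ^ 2 * q.1, x - y.2 - ρ • q.2) : SpT d))
        (by fun_prop)

lemma cylInt_smear_le {k f : SpT d → ℝ≥0∞} (hk : Measurable k) (hk1 : ∫⁻ y, k y = 1)
    (hf : Measurable f) {ρ : ℝ} {B : ℝ≥0∞} (h : ∀ t x, cylInt f ρ t x ≤ B) (t : ℝ) (x : Spc d) :
    cylInt (smear k f) ρ t x ≤ B := by
  rw [cylInt_smear hk hf]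
  calc ∫⁻ y, k y * cylInt f ρ (t - y.1) (x - y.2) ≤ ∫⁻ y, k y * B :=
        lintegral_mono fun y => mul_le_mul' le_rfl (h _ _)
    _ = B := by rw [lintegral_mul_const _ hk, hk1, one_mul]

/-- The truncated potential in the space variable of a function on space-time. -/
def sliceTruncPot (η : Spc d → ℝ≥0∞) (R : ℝ) (f : SpT d → ℝ≥0∞) (z : SpT d) : ℝ≥0∞ :=
  truncPot η R (fun y => f (z.1, y)) z.2

lemma sliceTruncPot_eq {η : Spc d → ℝ≥0∞} (hη : Measurable η) (R : ℝ) {f : SpT d → ℝ≥0∞}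
    (hf : Measurable f) (z : SpT d) :
    sliceTruncPot η R f z = ∫⁻ q : ℝ × Spc d, η q.2 * f (z - (0, q.1 • q.2))
      ∂((volume.restrict (Ioc 0 R)).prod volume) := by
  rw [lintegral_prod]
  · simp only [sliceTruncPot, truncPot]
    refine lintegral_congr fun s => lintegral_congr fun w => ?_
    congr 2
    ext1 <;> simp
  · refine Measurable.aemeasurable ((hη.comp measurable_snd).mul (hf.comp ?_))
    fun_prop

lemma measurable_sliceTruncPot {η : Spc d → ℝ≥0∞} (hη : Measurable η) (R : ℝ)
    {f : SpT d → ℝ≥0∞} (hf : Measurable f) : Measurable (sliceTruncPot η R f) := by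
  simp only [funext (sliceTruncPot_eq hη R hf)]
  refine Measurable.lintegral_prod_right'
    (f := fun q : SpT d × (ℝ × Spc d) => η q.2.2 * f (q.1 - (0, q.2.1 • q.2.2))) ?_
  refine (hη.comp (measurable_snd.comp measurable_snd)).mul (hf.comp ?_)
  fun_prop

lemma sliceTruncPot_smear {η : Spc d → ℝ≥0∞} (hη : Measurable η) (R : ℝ)
    {k f : SpT d → ℝ≥0∞} (hk : Measurable k) (hf : Measurable f) (z : SpT d) :
    sliceTruncPot η R (smear k f) z = smear k (sliceTruncPot η R f) z := by
  rw [sliceTruncPot_eq hη R (measurable_smear hk hf), smear]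
  simp only [funext (sliceTruncPot_eq hη R hf), smear]
  have hm : ∀ y : SpT d, Measurable fun q : ℝ × Spc d => η q.2 * f (z - y - (0, q.1 • q.2)) := by
    intro y
    refine (hη.comp measurable_snd).mul (hf.comp ?_)
    fun_prop
  have hm2 : ∀ q : ℝ × Spc d, Measurable fun y : SpT d => k y * f (z - (0, q.1 • q.2) - y) := by
    intro q
    refine hk.mul (hf.comp ?_)
    fun_prop
  have hm3 : Measurable fun q : (ℝ × Spc d) × SpT d =>
      η q.1.2 * (k q.2 * f (z - (0, q.1.1 • q.1.2) - q.2)) := by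
    refine (hη.comp (measurable_snd.comp measurable_fst)).mul
      ((hk.comp measurable_snd).mul (hf.comp ?_))
    fun_prop
  simp only [← lintegral_const_mul _ (hm _), ← lintegral_const_mul _ (hm2 _)]
  rw [lintegral_lintegral_swap hm3.aemeasurable]
  refine lintegral_congr fun y => lintegral_congr fun q => ?_
  rw [sub_right_comm]
  ring

lemma cylInt_sliceTruncPot_le {η : Spc d → ℝ≥0∞} (hη : Measurable η) (hη1 : ∫⁻ w, η w = 1)
    (R : ℝ) {f : SpT d → ℝ≥0∞} (hf : Measurable f) {B : ℝ≥0∞}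
    (h : ∀ t x, cylInt f 1 t x ≤ B) (t : ℝ) (x : Spc d) :
    cylInt (sliceTruncPot η R f) 1 t x ≤ ENNReal.ofReal R * B := by
  rw [← setLIntegral_cylinder_one (measurable_sliceTruncPot hη R hf)]
  simp only [funext (sliceTruncPot_eq hη R hf)]
  have hm : Measurable fun q : SpT d × (ℝ × Spc d) =>
      η q.2.2 * f (q.1 - (0, q.2.1 • q.2.2)) := by
    refine (hη.comp (measurable_snd.comp measurable_snd)).mul (hf.comp ?_)
    fun_prop
  rw [lintegral_lintegral_swap hm.aemeasurable]
  calc ∫⁻ q : ℝ × Spc d, (∫⁻ z in Ico t (t + 1) ×ˢ ball x 1, η q.2 * f (z - (0, q.1 • q.2)))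
        ∂((volume.restrict (Ioc 0 R)).prod volume)
      ≤ ∫⁻ q : ℝ × Spc d, η q.2 * B ∂((volume.restrict (Ioc 0 R)).prod volume) := by
        refine lintegral_mono fun q => ?_
        have hmq : Measurable fun z : SpT d => f (z - (0, q.1 • q.2)) := hf.comp (by fun_prop)
        rw [lintegral_const_mul _ hmq, setLIntegral_cylinder_one hmq]
        refine mul_le_mul' le_rfl ((le_of_eq ?_).trans (h t (x - q.1 • q.2)))
        unfold cylInt
        refine lintegral_congr fun σ => lintegral_congr fun w => ?_
        simp [sub_right_comm]
    _ = ENNReal.ofReal R * B := by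
        have hms : Measurable fun q : ℝ × Spc d => η q.2 := hη.comp measurable_snd
        rw [lintegral_mul_const _ hms, lintegral_prod _ hms.aemeasurable]
        simp [hη1]

end Smearing

section Mollification

variable {d : ℕ}

instance isAddHaarMeasure_volume_SpT : (volume : Measure (SpT d)).IsAddHaarMeasure :=
  inferInstanceAs ((volume : Measure ℝ).prod (volume : Measure (Spc d))).IsAddHaarMeasure

/-- The mollification of `u` by a normalized bump function. -/
def bumpMollify (φ : ContDiffBump (0 : SpT d)) (u : SpT d → ℝ) : SpT d → ℝ :=
  convolution (φ.normed volume) u (ContinuousLinearMap.lsmul ℝ ℝ) volume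

lemma bumpMollify_apply (φ : ContDiffBump (0 : SpT d)) (u : SpT d → ℝ) (z : SpT d) :
    bumpMollify φ u z = ∫ y, φ.normed volume y * u (z - y) := rfl

lemma contDiff_bumpMollify (φ : ContDiffBump (0 : SpT d)) {u : SpT d → ℝ}
    (hu : LocallyIntegrable u) : ContDiff ℝ (⊤ : ℕ∞) (bumpMollify φ u) :=
  φ.hasCompactSupport_normed.contDiff_convolution_left _ φ.contDiff_normed hu

/-- Mollification turns weak derivatives into classical ones. -/
lemma fderiv_bumpMollify (φ : ContDiffBump (0 : SpT d)) {u v : SpT d → ℝ}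
    (hu : LocallyIntegrable u) {e : SpT d} (h : IsWeakDeriv d u v e) (z : SpT d) :
    fderiv ℝ (bumpMollify φ u) z e = bumpMollify φ v z := by
  set ζ := φ.normed (volume : Measure (SpT d)) with hζ
  have hζs : ContDiff ℝ (⊤ : ℕ∞) ζ := φ.contDiff_normed
  have hζc : HasCompactSupport ζ := φ.hasCompactSupport_normed
  have hζ1 : ContDiff ℝ 1 ζ := hζs.of_le (by exact_mod_cast le_top)
  have hd := hζc.hasFDerivAt_convolution_left (ContinuousLinearMap.lsmul ℝ ℝ) hζ1 hu z
  have hex : ConvolutionExists (fderiv ℝ ζ) u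
      ((ContinuousLinearMap.lsmul ℝ ℝ).precompL (SpT d)) volume :=
    (hζc.fderiv ℝ).convolutionExists_left _ (hζ1.continuous_fderiv (by simp)) hu
  have e1 : fderiv ℝ (bumpMollify φ u) z e = ∫ y, fderiv ℝ ζ y e * u (z - y) := by
    rw [show fderiv ℝ (bumpMollify φ u) z = _ from hd.fderiv, convolution_def,
      ContinuousLinearMap.integral_apply (hex z)]
    rfl
  set θ : SpT d → ℝ := fun y => ζ (z - y) with hθ
  have hθs : ContDiff ℝ (⊤ : ℕ∞) θ := hζs.comp (contDiff_const.sub contDiff_id)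
  have hθc : HasCompactSupport θ := hζc.comp_homeomorph (Homeomorph.subLeft z)
  have hθd : ∀ y, fderiv ℝ θ y e = - fderiv ℝ ζ (z - y) e := by
    intro y
    have h1 : HasFDerivAt (fun y : SpT d => z - y) (-(ContinuousLinearMap.id ℝ (SpT d))) y :=
      (hasFDerivAt_id y).const_sub z
    have h2 : HasFDerivAt θ ((fderiv ℝ ζ (z - y)).comp (-(ContinuousLinearMap.id ℝ (SpT d)))) y :=
      ((hζ1.differentiable (by simp)) (z - y)).hasFDerivAt.comp y h1
    rw [h2.fderiv]
    simp
  have key := h θ hθs hθc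
  simp only [hθd, mul_neg, integral_neg, neg_inj] at key
  rw [e1, bumpMollify_apply, ← integral_sub_left_eq_self _ _ z]
  rw [← integral_sub_left_eq_self (fun y => φ.normed volume y * v (z - y)) _ z]
  simp only [_root_.sub_sub_cancel]
  simpa only [mul_comm] using key

lemma IsWeakDeriv.deriv_of_isWeakDeriv2 {u v w : SpT d → ℝ} {e₁ e₂ : SpT d}
    (hv : IsWeakDeriv d u v e₂) (hw : IsWeakDeriv2 d u w e₁ e₂) : IsWeakDeriv d v w e₁ := by
  intro φ hφ hφc
  have hs : ContDiff ℝ (⊤ : ℕ∞) fun z => fderiv ℝ φ z e₁ :=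
    (hφ.fderiv_right (m := (⊤ : ℕ∞)) (by simp)).clm_apply contDiff_const
  have h1 := hv _ hs (hφc.fderiv_apply (𝕜 := ℝ) e₁)
  rw [hw φ hφ hφc] at h1
  rw [h1, neg_neg]

/-- The nonnegative extended-real version of a normalized bump function. -/
def bumpKernel (φ : ContDiffBump (0 : SpT d)) (y : SpT d) : ℝ≥0∞ :=
  ENNReal.ofReal (φ.normed volume y)

lemma measurable_bumpKernel (φ : ContDiffBump (0 : SpT d)) : Measurable (bumpKernel φ) :=
  φ.continuous_normed.measurable.ennreal_ofReal

lemma lintegral_bumpKernel (φ : ContDiffBump (0 : SpT d)) : ∫⁻ y, bumpKernel φ y = 1 := by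
  unfold bumpKernel
  rw [← ofReal_integral_eq_lintegral_ofReal φ.integrable_normed
    (Eventually.of_forall φ.nonneg_normed), φ.integral_normed, ENNReal.ofReal_one]

lemma ae_sub_left {P : SpT d → Prop} (h : ∀ᵐ z, P z) (z : SpT d) : ∀ᵐ y, P (z - y) :=
  (Measure.measurePreserving_sub_left volume z).quasiMeasurePreserving.ae h

lemma enorm_bumpMollify_le (φ : ContDiffBump (0 : SpT d)) {v : SpT d → ℝ} {f : SpT d → ℝ≥0∞}
    (hvf : ∀ᵐ z, ‖v z‖ₑ ≤ f z) (z : SpT d) :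
    ‖bumpMollify φ v z‖ₑ ≤ smear (bumpKernel φ) f z := by
  rw [bumpMollify_apply]
  refine (enorm_integral_le_lintegral_enorm _).trans (lintegral_mono_ae ?_)
  filter_upwards [ae_sub_left hvf z] with y hy
  rw [enorm_mul, Real.enorm_of_nonneg (φ.nonneg_normed y)]
  exact mul_le_mul' le_rfl hy

lemma smear_bumpKernel_eq (φ : ContDiffBump (0 : SpT d)) {f : SpT d → ℝ≥0∞}
    (hf : ∀ᵐ z, f z ≠ ⊤) (hfi : LocallyIntegrable fun z => (f z).toReal) (z : SpT d) :
    smear (bumpKernel φ) f z = ENNReal.ofReal (bumpMollify φ (fun z => (f z).toReal) z) := by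
  have hex : ConvolutionExists (φ.normed volume) (fun z => (f z).toReal)
      (ContinuousLinearMap.lsmul ℝ ℝ) volume :=
    φ.hasCompactSupport_normed.convolutionExists_left _ φ.continuous_normed hfi
  rw [bumpMollify_apply]
  rw [ofReal_integral_eq_lintegral_ofReal (f := fun y => φ.normed volume y * (f (z - y)).toReal)
    (hex z)
    (Eventually.of_forall fun y => mul_nonneg (φ.nonneg_normed y) ENNReal.toReal_nonneg)]
  refine lintegral_congr_ae ?_
  filter_upwards [ae_sub_left hf z] with y hy
  rw [ENNReal.ofReal_mul (φ.nonneg_normed y), ENNReal.ofReal_toReal hy]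
  rfl

end Mollification

section PointwiseBound

variable {d : ℕ} {η : Spc d → ℝ} {M : ℝ}

lemma enorm_clm_le_sum_dirS (L : SpT d →L[ℝ] ℝ) {w : Spc d} (hw : w ∈ ball (0 : Spc d) 1) :
    ‖L (0, w)‖ₑ ≤ ∑ j, ‖L (dirS d j)‖ₑ := by
  have e : ((0, w) : SpT d) = ∑ j, w j • dirS d j := by
    ext1
    · simp [dirS, Prod.fst_sum]
    · ext k
      simp [dirS, Prod.snd_sum, Pi.single_apply]
  rw [e, map_sum]
  refine (enorm_sum_le _ _).trans (Finset.sum_le_sum fun j _ => ?_)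
  rw [map_smul, smul_eq_mul, enorm_mul]
  refine mul_le_of_le_one_left zero_le ?_
  rw [Real.enorm_eq_ofReal_abs, ENNReal.ofReal_le_one]
  have h1 : |w j| ≤ ‖w‖ := by simpa using PiLp.norm_apply_le w j
  have h2 : ‖w‖ < 1 := by simpa using hw
  exact h1.trans h2.le

lemma smear_const_mul {k f : SpT d → ℝ≥0∞} {c : ℝ≥0∞} (hc : c ≠ ⊤) (z : SpT d) :
    smear k (fun z => c * f z) z = c * smear k f z := by
  unfold smear
  rw [← lintegral_const_mul' _ _ hc]
  exact lintegral_congr fun y => by ring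

/-- Mollified form of the pointwise bound for the gradient. -/
lemma enorm_bumpMollify_le_truncPot_add (h : IsKernel η M) (φ : ContDiffBump (0 : SpT d))
    {u : SpT d → ℝ} {v : SpT d → ℝ} {w : Fin d → SpT d → ℝ} {ut : SpT d → ℝ} {i : Fin d}
    (hu : LocallyIntegrable u) (hv : LocallyIntegrable v)
    (huv : IsWeakDeriv d u v (dirS d i)) (hvw : ∀ j, IsWeakDeriv d v (w j) (dirS d j))
    (hut : IsWeakDeriv d u ut (dirT d)) {F G P : SpT d → ℝ≥0∞} (hF : Measurable F)
    (hG : Measurable G) (hP : Measurable P) (hwF : ∀ j, ∀ᵐ z, ‖w j z‖ₑ ≤ F z)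
    (hutG : ∀ᵐ z, ‖ut z‖ₑ ≤ G z) (hvP : ∀ᵐ z, ‖v z‖ₑ ≤ P z) {β A : ℝ} (hβ : 1 < β) (hA : 0 ≤ A)
    (hcF : ∀ ρ t x, 0 < ρ → ρ ≤ 1 →
      cylInt (fun z => d * F z) ρ t x ≤ ENNReal.ofReal (A * ρ ^ (-β)))
    (hcG : ∀ ρ t x, 0 < ρ → ρ ≤ 1 → cylInt G ρ t x ≤ ENNReal.ofReal (A * ρ ^ (-β)))
    (hcP : ∀ ρ t x, 0 < ρ → ρ ≤ 1 → cylInt P ρ t x ≤ ENNReal.ofReal (A * ρ ^ (-β)))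
    {R : ℝ} (hR : 0 < R) (hR1 : R ≤ 1) (z : SpT d) :
    ‖bumpMollify φ v z‖ₑ
      ≤ smear (bumpKernel φ)
          (sliceTruncPot (fun w => ENNReal.ofReal (η w)) R fun z => d * F z) z
        + ENNReal.ofReal (M * (2 + 3 / (β - 1)) * A * R ^ (1 - β)) := by
  have hk := measurable_bumpKernel φ
  have hk1 := lintegral_bumpKernel φ
  have hdF : Measurable fun z => (d : ℝ≥0∞) * F z := hF.const_mul _
  have hVi : (fun z => fderiv ℝ (bumpMollify φ u) z (dirS d i)) = bumpMollify φ v :=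
    funext fun z => fderiv_bumpMollify φ hu huv z
  have key := enorm_fderiv_le_truncPot_add h (contDiff_bumpMollify φ hu) i
    (F := smear (bumpKernel φ) fun z => d * F z) (G := smear (bumpKernel φ) G)
    (P := smear (bumpKernel φ) P) (measurable_smear hk hdF) (measurable_smear hk hG)
    (fun z w hw => by
      rw [hVi]
      refine (enorm_clm_le_sum_dirS _ hw).trans ?_
      rw [smear_const_mul (ENNReal.natCast_ne_top d)]
      calc _ ≤ ∑ j : Fin d, smear (bumpKernel φ) F z := Finset.sum_le_sum fun j _ => by
            rw [fderiv_bumpMollify φ hv (hvw j)]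
            exact enorm_bumpMollify_le φ (hwF j) z
        _ = d * smear (bumpKernel φ) F z := by simp)
    (fun z => by
      rw [fderiv_bumpMollify φ hu hut]
      exact enorm_bumpMollify_le φ hutG z)
    (fun z => by
      rw [fderiv_bumpMollify φ hu huv]
      exact enorm_bumpMollify_le φ hvP z) hβ hA
    (fun ρ t x h0 h1 => cylInt_smear_le hk hk1 hdF (fun t x => hcF ρ t x h0 h1) t x)
    (fun ρ t x h0 h1 => cylInt_smear_le hk hk1 hG (fun t x => hcG ρ t x h0 h1) t x)
    (fun ρ t x h0 h1 => cylInt_smear_le hk hk1 hP (fun t x => hcP ρ t x h0 h1) t x)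
    hR hR1 z.1 z.2
  rw [← sliceTruncPot_smear h.measurable_ofReal R hk hdF]
  rw [show ((z.1, z.2) : SpT d) = z from rfl, fderiv_bumpMollify φ hu huv] at key
  exact key

/-- Pointwise control of a weak gradient by a truncated potential of the Hessian at a fixed
    radius. -/
lemma ae_enorm_le_sliceTruncPot_add (h : IsKernel η M)
    {u : SpT d → ℝ} {v : SpT d → ℝ} {w : Fin d → SpT d → ℝ} {ut : SpT d → ℝ} {i : Fin d}
    (hu : LocallyIntegrable u) (hv : LocallyIntegrable v)
    (huv : IsWeakDeriv d u v (dirS d i)) (hvw : ∀ j, IsWeakDeriv d v (w j) (dirS d j))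
    (hut : IsWeakDeriv d u ut (dirT d)) {F G P : SpT d → ℝ≥0∞} (hF : Measurable F)
    (hG : Measurable G) (hP : Measurable P) (hwF : ∀ j, ∀ᵐ z, ‖w j z‖ₑ ≤ F z)
    (hutG : ∀ᵐ z, ‖ut z‖ₑ ≤ G z) (hvP : ∀ᵐ z, ‖v z‖ₑ ≤ P z) {β A : ℝ} (hβ : 1 < β) (hA : 0 ≤ A)
    (hcF : ∀ ρ t x, 0 < ρ → ρ ≤ 1 →
      cylInt (fun z => d * F z) ρ t x ≤ ENNReal.ofReal (A * ρ ^ (-β)))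
    (hcG : ∀ ρ t x, 0 < ρ → ρ ≤ 1 → cylInt G ρ t x ≤ ENNReal.ofReal (A * ρ ^ (-β)))
    (hcP : ∀ ρ t x, 0 < ρ → ρ ≤ 1 → cylInt P ρ t x ≤ ENNReal.ofReal (A * ρ ^ (-β)))
    {R : ℝ} (hR : 0 < R) (hR1 : R ≤ 1) :
    ∀ᵐ z, ‖v z‖ₑ ≤ sliceTruncPot (fun w => ENNReal.ofReal (η w)) R (fun z => d * F z) z
        + ENNReal.ofReal (M * (2 + 3 / (β - 1)) * A * R ^ (1 - β)) := by
  set T := sliceTruncPot (fun w => ENNReal.ofReal (η w)) R fun z => d * F z with hT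
  have hdF : Measurable fun z => (d : ℝ≥0∞) * F z := hF.const_mul _
  have hTm : Measurable T := measurable_sliceTruncPot h.measurable_ofReal R hdF
  have hTc : ∀ t x, cylInt T 1 t x ≤ ENNReal.ofReal R * ENNReal.ofReal (A * 1 ^ (-β)) :=
    cylInt_sliceTruncPot_le h.measurable_ofReal h.lintegral_ofReal R hdF
      fun t x => hcF 1 t x one_pos le_rfl
  have hTi : LocallyIntegrable fun z => (T z).toReal := by
    refine locallyIntegrable_of_cylInt_le hTm.ennreal_toReal.aestronglyMeasurable hTm
      (Eventually.of_forall fun z => ?_) (by finiteness) hTc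
    rw [Real.enorm_of_nonneg ENNReal.toReal_nonneg]
    exact ENNReal.ofReal_toReal_le
  have hTfin : ∀ᵐ z, T z ≠ ⊤ := by
    have hnull : ∀ n : SpT d, ∃ s ∈ 𝓝 n, volume (s ∩ {z | T z = ⊤}) = 0 := by
      intro z
      refine ⟨Ico (z.1 - 1 / 2) (z.1 - 1 / 2 + 1) ×ˢ ball z.2 1, ?_, ?_⟩
      · rw [show z = (z.1, z.2) from rfl]
        exact prod_mem_nhds (Ico_mem_nhds (by simp) (by dsimp; linarith))
          (ball_mem_nhds _ one_pos)
      · have hfin : ∫⁻ z in Ico (z.1 - 1 / 2) (z.1 - 1 / 2 + 1) ×ˢ ball z.2 1, T z ≠ ⊤ := by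
          rw [setLIntegral_cylinder_one hTm]
          exact ((hTc _ _).trans_lt (by finiteness)).ne
        have := ae_lt_top hTm hfin
        rw [ae_iff, Measure.restrict_apply' (measurableSet_Ico.prod measurableSet_ball)] at this
        rw [inter_comm]
        simpa using this
    rw [ae_iff]
    refine measure_null_of_locally_null _ fun z _ => ?_
    obtain ⟨s, hs, hs0⟩ := hnull z
    refine ⟨s ∩ {z | ¬ T z ≠ ⊤}, ?_, by simpa using hs0⟩
    exact inter_mem (mem_nhdsWithin_of_mem_nhds hs) self_mem_nhdsWithin
  let φ : ℕ → ContDiffBump (0 : SpT d) := fun n =>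
    { rIn := 1 / ((n : ℝ) + 1)
      rOut := 2 * (1 / ((n : ℝ) + 1))
      rIn_pos := Nat.one_div_pos_of_nat
      rIn_lt_rOut := by
        have : 0 < 1 / ((n : ℝ) + 1) := Nat.one_div_pos_of_nat
        linarith }
  have hφ : Tendsto (fun n => (φ n).rOut) atTop (𝓝 0) := by
    have := (tendsto_one_div_add_atTop_nhds_zero_nat (𝕜 := ℝ)).const_mul 2
    rwa [mul_zero] at this
  have hφ2 : ∀ᶠ n in atTop, (φ n).rOut ≤ 2 * (φ n).rIn := Eventually.of_forall fun n => le_rfl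
  filter_upwards [ContDiffBump.ae_convolution_tendsto_right_of_locallyIntegrable hφ hφ2 hv,
    ContDiffBump.ae_convolution_tendsto_right_of_locallyIntegrable hφ hφ2 hTi, hTfin]
    with z hz1 hz2 hz3
  have l1 : Tendsto (fun n => ‖bumpMollify (φ n) v z‖ₑ) atTop (𝓝 ‖v z‖ₑ) := hz1.enorm
  have l2 : Tendsto (fun n => ENNReal.ofReal (bumpMollify (φ n) (fun z => (T z).toReal) z)
      + ENNReal.ofReal (M * (2 + 3 / (β - 1)) * A * R ^ (1 - β))) atTop
      (𝓝 (ENNReal.ofReal (T z).toReal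
        + ENNReal.ofReal (M * (2 + 3 / (β - 1)) * A * R ^ (1 - β)))) :=
    (ENNReal.tendsto_ofReal hz2).add tendsto_const_nhds
  rw [ENNReal.ofReal_toReal hz3] at l2
  refine le_of_tendsto_of_tendsto' l1 l2 fun n => ?_
  rw [← smear_bumpKernel_eq (φ n) hTfin hTi]
  exact enorm_bumpMollify_le_truncPot_add h (φ n) hu hv huv hvw hut hF hG hP hwF hutG hvP hβ hA
    hcF hcG hcP hR hR1 z

lemma truncPot_mono_radius {d : ℕ} (η : Spc d → ℝ≥0∞) {R R' : ℝ} (hR : R ≤ R')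
    (f : Spc d → ℝ≥0∞) (x : Spc d) : truncPot η R f x ≤ truncPot η R' f x :=
  lintegral_mono_set (Ioc_subset_Ioc_right hR)

/-- Pointwise control of a weak gradient by truncated potentials of the Hessian, simultaneously
    at all radii. -/
lemma ae_forall_enorm_le_sliceTruncPot_add (h : IsKernel η M)
    {u : SpT d → ℝ} {v : SpT d → ℝ} {w : Fin d → SpT d → ℝ} {ut : SpT d → ℝ} {i : Fin d}
    (hu : LocallyIntegrable u) (hv : LocallyIntegrable v)
    (huv : IsWeakDeriv d u v (dirS d i)) (hvw : ∀ j, IsWeakDeriv d v (w j) (dirS d j))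
    (hut : IsWeakDeriv d u ut (dirT d)) {F G P : SpT d → ℝ≥0∞} (hF : Measurable F)
    (hG : Measurable G) (hP : Measurable P) (hwF : ∀ j, ∀ᵐ z, ‖w j z‖ₑ ≤ F z)
    (hutG : ∀ᵐ z, ‖ut z‖ₑ ≤ G z) (hvP : ∀ᵐ z, ‖v z‖ₑ ≤ P z) {β A : ℝ} (hβ : 1 < β) (hA : 0 ≤ A)
    (hcF : ∀ ρ t x, 0 < ρ → ρ ≤ 1 →
      cylInt (fun z => d * F z) ρ t x ≤ ENNReal.ofReal (A * ρ ^ (-β)))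
    (hcG : ∀ ρ t x, 0 < ρ → ρ ≤ 1 → cylInt G ρ t x ≤ ENNReal.ofReal (A * ρ ^ (-β)))
    (hcP : ∀ ρ t x, 0 < ρ → ρ ≤ 1 → cylInt P ρ t x ≤ ENNReal.ofReal (A * ρ ^ (-β))) :
    ∀ᵐ z, ∀ R, 0 < R → R ≤ 1 →
      ‖v z‖ₑ ≤ sliceTruncPot (fun w => ENNReal.ofReal (η w)) R (fun z => d * F z) z
        + ENNReal.ofReal (2 ^ (β - 1) * (M * (2 + 3 / (β - 1))) * A * R ^ (1 - β)) := by
  have hrat : ∀ᵐ z, ∀ R : ℚ, 0 < (R : ℝ) → (R : ℝ) ≤ 1 →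
      ‖v z‖ₑ ≤ sliceTruncPot (fun w => ENNReal.ofReal (η w)) R (fun z => d * F z) z
        + ENNReal.ofReal (M * (2 + 3 / (β - 1)) * A * (R : ℝ) ^ (1 - β)) := by
    rw [ae_all_iff]
    intro R
    by_cases hR : 0 < (R : ℝ) ∧ (R : ℝ) ≤ 1
    · filter_upwards [ae_enorm_le_sliceTruncPot_add h hu hv huv hvw hut hF hG hP hwF hutG hvP hβ
        hA hcF hcG hcP hR.1 hR.2] with z hz _ _
      exact hz
    · exact Eventually.of_forall fun z h0 h1 => absurd ⟨h0, h1⟩ hR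
  filter_upwards [hrat] with z hz R hR hR1
  obtain ⟨S, hS1, hS2⟩ := exists_rat_btwn (show R / 2 < R by linarith)
  have hS0 : 0 < (S : ℝ) := by linarith
  refine (hz S hS0 (hS2.le.trans hR1)).trans (add_le_add ?_ (ENNReal.ofReal_le_ofReal ?_))
  · exact truncPot_mono_radius _ hS2.le _ _
  · have hM := h.bound_nonneg
    have hb : 0 ≤ 2 + 3 / (β - 1) := by
      have : 0 ≤ 3 / (β - 1) := div_nonneg (by norm_num) (by linarith)
      linarith
    have e : (S : ℝ) ^ (1 - β) ≤ 2 ^ (β - 1) * R ^ (1 - β) := by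
      calc (S : ℝ) ^ (1 - β) ≤ (R / 2) ^ (1 - β) :=
            Real.rpow_le_rpow_of_nonpos (by linarith) hS1.le (by linarith)
        _ = 2 ^ (β - 1) * R ^ (1 - β) := by
            rw [Real.div_rpow hR.le (by norm_num), show 1 - β = -(β - 1) by ring,
              Real.rpow_neg (by norm_num : (0 : ℝ) ≤ 2), div_inv_eq_mul, mul_comm]
    calc M * (2 + 3 / (β - 1)) * A * (S : ℝ) ^ (1 - β)
        ≤ M * (2 + 3 / (β - 1)) * A * (2 ^ (β - 1) * R ^ (1 - β)) := by gcongr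
      _ = _ := by ring

end PointwiseBound

lemma exists_isKernel (d : ℕ) : ∃ (η : Spc d → ℝ) (M : ℝ), 0 < M ∧ IsKernel η M := by
  let φ : ContDiffBump (0 : Spc d) := ⟨1 / 4, 1 / 2, by norm_num, by norm_num⟩
  set η : Spc d → ℝ := φ.normed volume with hη
  have hs : ContDiff ℝ (⊤ : ℕ∞) η := φ.contDiff_normed
  have hc : HasCompactSupport η := φ.hasCompactSupport_normed
  obtain ⟨C₀, hC₀⟩ := hc.exists_bound_of_continuous hs.continuous
  obtain ⟨C₁, hC₁⟩ := (hc.fderiv (𝕜 := ℝ)).exists_bound_of_continuous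
    (hs.continuous_fderiv (by simp))
  have h₀ : 0 ≤ C₀ := (norm_nonneg _).trans (hC₀ 0)
  have h₁ : 0 ≤ C₁ := (norm_nonneg _).trans (hC₁ 0)
  refine ⟨η, 1 + C₀ + C₁, by positivity, hs, fun w => φ.nonneg_normed w, φ.integral_normed, ?_,
    fun w => ?_, fun w i => ?_⟩
  · rw [hη, φ.tsupport_normed_eq]
    exact closedBall_subset_ball (by norm_num)
  · have := (le_abs_self _).trans (hC₀ w)
    linarith
  · have := (fderiv ℝ η w).le_opNorm (EuclideanSpace.single i 1)
    rw [Real.norm_eq_abs] at this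
    have h1 : ‖(EuclideanSpace.single i 1 : Spc d)‖ = 1 := by simp
    rw [h1, mul_one] at this
    linarith [hC₁ w]

lemma setLIntegral_div_measure_le {α : Type*} [MeasurableSpace α] {μ : Measure α} {s : Set α}
    (h0 : μ s ≠ 0) (ht : μ s ≠ ⊤) {f : α → ℝ≥0∞} (hf : Measurable f) {p : ℝ} (hp : 1 ≤ p) :
    (∫⁻ x in s, f x ∂μ) / μ s ≤ ((∫⁻ x in s, f x ^ p ∂μ) / μ s) ^ (1 / p) := by
  set ν : Measure α := (μ s)⁻¹ • μ.restrict s with hν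
  have : IsProbabilityMeasure ν := ⟨by simp [hν, ENNReal.inv_mul_cancel h0 ht]⟩
  have key : ∫⁻ x, f x ∂ν ≤ (∫⁻ x, f x ^ p ∂ν) ^ (1 / p) := by
    have := eLpNorm'_le_eLpNorm'_of_exponent_le (μ := ν) (f := f) one_pos hp hf.aestronglyMeasurable
    simpa [eLpNorm'] using this
  simpa [hν, lintegral_smul_measure, ENNReal.div_eq_inv_mul] using key

section MorreyNorm

variable {d : ℕ} {p q β : ℝ}

lemma avgLpq_congr {f g : SpT d → ℝ} (h : f =ᵐ[volume] g) (ρ t : ℝ) (x : Spc d) :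
    avgLpq d p q ρ t x f = avgLpq d p q ρ t x g := by
  have h' : ∀ᵐ τ : ℝ, ∀ᵐ y : Spc d, f (τ, y) = g (τ, y) := by
    rw [Measure.volume_eq_prod] at h
    exact Measure.ae_ae_of_ae_prod h
  unfold avgLpq
  congr 2
  refine lintegral_congr_ae (ae_restrict_of_ae ?_)
  filter_upwards [h'] with τ hτ
  congr 2
  refine lintegral_congr_ae (ae_restrict_of_ae ?_)
  filter_upwards [hτ] with y hy
  rw [hy]

lemma morreyNorm_congr {f g : SpT d → ℝ} (h : f =ᵐ[volume] g) :
    morreyNorm d p q β f = morreyNorm d p q β g := by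
  simp only [morreyNorm, avgLpq_congr h]

lemma avgLpq_le_of_morreyNorm_le {f : SpT d → ℝ} {K : ℝ}
    (h : morreyNorm d p q β f ≤ ENNReal.ofReal K) {ρ : ℝ} (hρ : 0 < ρ) (hρ1 : ρ ≤ 1) (t : ℝ)
    (x : Spc d) : avgLpq d p q ρ t x f ≤ ENNReal.ofReal (K * ρ ^ (-β)) := by
  have h1 : ENNReal.ofReal (ρ ^ β) * avgLpq d p q ρ t x f ≤ ENNReal.ofReal K := by
    refine le_trans ?_ h
    unfold morreyNorm
    exact le_iSup_of_le ρ (le_iSup_of_le hρ (le_iSup_of_le hρ1 (le_iSup_of_le t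
      (le_iSup_of_le x le_rfl))))
  have hpos : 0 < ρ ^ β := Real.rpow_pos_of_pos hρ _
  rw [Real.rpow_neg hρ.le, ← div_eq_mul_inv, ENNReal.ofReal_div_of_pos hpos]
  rw [ENNReal.le_div_iff_mul_le (by simp [hpos]) (by simp), mul_comm]
  exact h1

lemma cylInt_le_avgLpq {a : SpT d → ℝ} (ha : Measurable a) (hp : 1 ≤ p) (hq : 1 ≤ q) {ρ : ℝ}
    (hρ : 0 < ρ) (t : ℝ) (x : Spc d) :
    cylInt (fun z => ENNReal.ofReal |a z|) ρ t x
      ≤ volume (ball (0 : Spc d) 1) * avgLpq d p q ρ t x a := by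
  have hm : Measurable fun z : SpT d => ENNReal.ofReal |a z| :=
    ENNReal.measurable_ofReal.comp (measurable_abs.comp ha)
  rw [cylInt_eq hm hρ]
  refine mul_le_mul' le_rfl ?_
  have hB0 : volume (ball x ρ) ≠ 0 := (measure_ball_pos volume x hρ).ne'
  have hBt : volume (ball x ρ) ≠ ⊤ := measure_ball_lt_top.ne
  have hvol : volume (Ico t (t + ρ ^ 2)) = ENNReal.ofReal (ρ ^ 2) := by simp
  set m : ℝ → ℝ≥0∞ := fun τ =>
    ((∫⁻ y in ball x ρ, ENNReal.ofReal |a (τ, y)| ^ p) / volume (ball x ρ)) ^ (1 / p) with hmdef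
  have hmm : Measurable m := by
    have : Measurable fun τ : ℝ => ∫⁻ y in ball x ρ, ENNReal.ofReal |a (τ, y)| ^ p :=
      (hm.pow_const p).lintegral_prod_right' (ν := volume.restrict (ball x ρ))
    exact (this.div_const _).pow_const _
  calc (∫⁻ τ in Ico t (t + ρ ^ 2), (∫⁻ y in ball x ρ, ENNReal.ofReal |a (τ, y)|)
          / volume (ball x ρ)) / ENNReal.ofReal (ρ ^ 2)
      ≤ (∫⁻ τ in Ico t (t + ρ ^ 2), m τ) / ENNReal.ofReal (ρ ^ 2) := by
        refine ENNReal.div_le_div_right (lintegral_mono fun τ => ?_) _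
        exact setLIntegral_div_measure_le hB0 hBt (hm.comp measurable_prodMk_left) hp
    _ ≤ ((∫⁻ τ in Ico t (t + ρ ^ 2), m τ ^ q) / ENNReal.ofReal (ρ ^ 2)) ^ (1 / q) := by
        have := setLIntegral_div_measure_le (μ := volume) (s := Ico t (t + ρ ^ 2))
          (by simp [hρ.ne']) (by simp) hmm hq
        rwa [hvol] at this
    _ = avgLpq d p q ρ t x a := by
        unfold avgLpq
        simp only [hmdef, ← ENNReal.rpow_mul]
        rw [show 1 / p * q = q / p by ring]

lemma cylInt_const_mul {c : ℝ≥0∞} (hc : c ≠ ⊤) (f : SpT d → ℝ≥0∞) (ρ t : ℝ) (x : Spc d) :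
    cylInt (fun z => c * f z) ρ t x = c * cylInt f ρ t x := by
  simp only [cylInt, lintegral_const_mul' c _ hc]

lemma cylInt_le_of_morreyNorm_le {a : SpT d → ℝ} (ha : Measurable a) (hp : 1 ≤ p) (hq : 1 ≤ q)
    {K : ℝ} (h : morreyNorm d p q β a ≤ ENNReal.ofReal K) {ρ : ℝ} (hρ : 0 < ρ) (hρ1 : ρ ≤ 1) (t : ℝ)
    (x : Spc d) :
    cylInt (fun z => ENNReal.ofReal |a z|) ρ t x
      ≤ ENNReal.ofReal (volume.real (ball (0 : Spc d) 1) * K * ρ ^ (-β)) := by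
  refine (cylInt_le_avgLpq (p := p) (q := q) ha hp hq hρ t x).trans ?_
  rw [mul_assoc, ENNReal.ofReal_mul measureReal_nonneg, ofReal_measureReal]
  exact mul_le_mul' le_rfl (avgLpq_le_of_morreyNorm_le h hρ hρ1 t x)

end MorreyNorm

section GradientBound

variable {d : ℕ}

lemma gradMag_nonneg (Du : Fin d → SpT d → ℝ) (z : SpT d) : 0 ≤ gradMag d Du z := Real.sqrt_nonneg _

lemma abs_le_gradMag (Du : Fin d → SpT d → ℝ) (i : Fin d) (z : SpT d) :
    |Du i z| ≤ gradMag d Du z := by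
  rw [← Real.sqrt_sq_eq_abs]
  exact Real.sqrt_le_sqrt
    (Finset.single_le_sum (f := fun i => Du i z ^ 2) (fun j _ => sq_nonneg _) (Finset.mem_univ i))

lemma gradMag_le_sum (Du : Fin d → SpT d → ℝ) (z : SpT d) : gradMag d Du z ≤ ∑ i, |Du i z| := by
  have h0 : 0 ≤ ∑ i, |Du i z| := Finset.sum_nonneg fun i _ => abs_nonneg _
  refine Real.sqrt_le_iff.2 ⟨h0, ?_⟩
  have := Finset.sum_sq_le_sq_sum_of_nonneg (s := Finset.univ) (f := fun i => |Du i z|)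
    (fun i _ => abs_nonneg _)
  simpa only [sq_abs] using this

lemma abs_le_hessMag (D2u : Fin d → Fin d → SpT d → ℝ) (i j : Fin d) (z : SpT d) :
    |D2u i j z| ≤ hessMag d D2u z := by
  rw [← Real.sqrt_sq_eq_abs]
  refine Real.sqrt_le_sqrt ?_
  refine (Finset.single_le_sum (f := fun j => D2u i j z ^ 2) (fun j _ => sq_nonneg _)
    (Finset.mem_univ j)).trans ?_
  exact Finset.single_le_sum (f := fun i => ∑ j, D2u i j z ^ 2)
    (fun i _ => Finset.sum_nonneg fun j _ => sq_nonneg _) (Finset.mem_univ i)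

lemma aemeasurable_gradMag {Du : Fin d → SpT d → ℝ} (h : ∀ i, AEStronglyMeasurable (Du i) volume) :
    AEMeasurable (gradMag d Du) volume :=
  Real.continuous_sqrt.measurable.comp_aemeasurable
    (Finset.aemeasurable_fun_sum _ fun i _ => (h i).aemeasurable.pow_const 2)

lemma aemeasurable_hessMag {D2u : Fin d → Fin d → SpT d → ℝ}
    (h : ∀ i j, AEStronglyMeasurable (D2u i j) volume) : AEMeasurable (hessMag d D2u) volume :=
  Real.continuous_sqrt.measurable.comp_aemeasurable
    (Finset.aemeasurable_fun_sum _ fun i _ => Finset.aemeasurable_fun_sum _ fun j _ =>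
      (h i j).aemeasurable.pow_const 2)

lemma truncPot_const_mul {η : Spc d → ℝ≥0∞} {c : ℝ≥0∞} (hc : c ≠ ⊤) (R : ℝ) (f : Spc d → ℝ≥0∞)
    (x : Spc d) : c * truncPot η R f x = truncPot η R (fun y => c * f y) x := by
  simp only [truncPot, mul_left_comm _ c, lintegral_const_mul' c _ hc]

lemma ae_ofReal_gradMag_le_truncPot_add {η : Spc d → ℝ} {M : ℝ} (h : IsKernel η M) (hd : 1 ≤ d)
    {p q β : ℝ} (hp : 1 < p) (hq : 1 < q) (hβ : 1 < β) {u : SpT d → ℝ} {Du : Fin d → SpT d → ℝ}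
    {D2u : Fin d → Fin d → SpT d → ℝ} {ut : SpT d → ℝ} (hu : Mem12 d p q β u Du D2u ut) {K : ℝ}
    (hK : 0 ≤ K) (hn : norm12 d p q β u Du D2u ut ≤ ENNReal.ofReal K) {a : SpT d → ℝ}
    (ha : Measurable a) (hea : hessMag d D2u =ᵐ[volume] a) :
    ∀ᵐ z : SpT d, ∀ R, 0 < R → R ≤ 1 →
      ENNReal.ofReal (gradMag d Du z) ≤ truncPot (fun w => ENNReal.ofReal (η w)) R
          (fun y => ENNReal.ofReal (d * d * |a (z.1, y)|)) z.2
        + ENNReal.ofReal (R ^ (1 - β) * (d * (2 ^ (β - 1) * (M * (2 + 3 / (β - 1)))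
            * (d * volume.real (ball (0 : Spc d) 1))) * K)) := by
  obtain ⟨⟨hum, -⟩, hDu, hD2u, hutw, hDum, hD2um, ⟨hutm, -⟩⟩ := hu
  set c₁ := volume.real (ball (0 : Spc d) 1) with hc₁
  have hc₁0 : 0 ≤ c₁ := measureReal_nonneg
  have hd1 : (1 : ℝ) ≤ d := by exact_mod_cast hd
  have hM := h.bound_nonneg
  have hβ0 : 0 < β - 1 := sub_pos.2 hβ
  have n1 : morreyNorm d p q β u ≤ ENNReal.ofReal K :=
    (le_self_add.trans (le_self_add.trans le_self_add)).trans hn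
  have n2 : morreyNorm d p q β (gradMag d Du) ≤ ENNReal.ofReal K :=
    (le_add_self.trans (le_self_add.trans le_self_add)).trans hn
  have n3 : morreyNorm d p q β (hessMag d D2u) ≤ ENNReal.ofReal K :=
    (le_add_self.trans le_self_add).trans hn
  have n4 : morreyNorm d p q β ut ≤ ENNReal.ofReal K := le_add_self.trans hn
  have cyl : ∀ {f b : SpT d → ℝ}, Measurable b → f =ᵐ[volume] b →
      morreyNorm d p q β f ≤ ENNReal.ofReal K → ∀ ρ t x, 0 < ρ → ρ ≤ 1 →
      cylInt (fun z => ENNReal.ofReal |b z|) ρ t x ≤ ENNReal.ofReal (c₁ * K * ρ ^ (-β)) :=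
    fun hb hfb hf ρ t x hρ hρ1 =>
      cylInt_le_of_morreyNorm_le hb hp.le hq.le (morreyNorm_congr hfb ▸ hf) hρ hρ1 t x
  have meas : ∀ {b : SpT d → ℝ}, Measurable b → Measurable fun z => ENNReal.ofReal |b z| :=
    fun hb => ENNReal.measurable_ofReal.comp (measurable_abs.comp hb)
  have dom : ∀ {v f b : SpT d → ℝ}, f =ᵐ[volume] b → (∀ z, |v z| ≤ |f z|) →
      ∀ᵐ z, ‖v z‖ₑ ≤ ENNReal.ofReal |b z| := by
    intro v f b hfb hvf
    filter_upwards [hfb] with z hz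
    rw [← hz, Real.enorm_eq_ofReal_abs]
    exact ENNReal.ofReal_le_ofReal (hvf z)
  have locInt : ∀ {v f b : SpT d → ℝ}, AEStronglyMeasurable v volume → Measurable b →
      f =ᵐ[volume] b → (∀ z, |v z| ≤ |f z|) → morreyNorm d p q β f ≤ ENNReal.ofReal K →
      LocallyIntegrable v := fun hv hb hfb hvf hf =>
    locallyIntegrable_of_cylInt_le (B := ENNReal.ofReal (c₁ * K)) hv (meas hb) (dom hfb hvf)
      ENNReal.ofReal_ne_top fun t x => by simpa using cyl hb hfb hf 1 t x one_pos le_rfl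
  have hug := hum.aemeasurable
  have hgg := aemeasurable_gradMag fun i => (hDum i).1
  have htg := hutm.aemeasurable
  have hgrad : ∀ i z, |Du i z| ≤ |gradMag d Du z| := fun i z =>
    (abs_le_gradMag Du i z).trans (le_abs_self _)
  have huL : LocallyIntegrable u :=
    locInt hum hug.measurable_mk hug.ae_eq_mk (fun _ => le_rfl) n1
  have hDL : ∀ i, LocallyIntegrable (Du i) := fun i =>
    locInt (hDum i).1 hgg.measurable_mk hgg.ae_eq_mk (hgrad i) n2
  have hA : c₁ * K ≤ d * c₁ * K := by
    rw [mul_assoc]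
    exact le_mul_of_one_le_left (by positivity) hd1
  have up : ∀ ρ : ℝ, 0 < ρ → ENNReal.ofReal (c₁ * K * ρ ^ (-β))
      ≤ ENNReal.ofReal (d * c₁ * K * ρ ^ (-β)) := fun ρ hρ =>
    ENNReal.ofReal_le_ofReal (mul_le_mul_of_nonneg_right hA (Real.rpow_nonneg hρ.le _))
  have main : ∀ i, _ := fun i => ae_forall_enorm_le_sliceTruncPot_add (i := i) h huL (hDL i) (hDu i)
    (fun j => (hDu i).deriv_of_isWeakDeriv2 (hD2u j i)) hutw (meas ha) (meas htg.measurable_mk)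
    (meas hgg.measurable_mk) (fun j => dom hea fun z =>
      (abs_le_hessMag D2u j i z).trans (le_abs_self _)) (dom htg.ae_eq_mk fun _ => le_rfl)
    (dom hgg.ae_eq_mk (hgrad i)) hβ (A := d * c₁ * K) (by positivity)
    (fun ρ t x hρ hρ1 => by
      rw [cylInt_const_mul (ENNReal.natCast_ne_top d)]
      refine (mul_le_mul' le_rfl (cyl ha hea n3 ρ t x hρ hρ1)).trans_eq ?_
      rw [← ENNReal.ofReal_natCast, ← ENNReal.ofReal_mul (by positivity)]
      congr 1
      ring)
    (fun ρ t x hρ hρ1 => (cyl htg.measurable_mk htg.ae_eq_mk n4 ρ t x hρ hρ1).trans (up ρ hρ))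
    (fun ρ t x hρ hρ1 => (cyl hgg.measurable_mk hgg.ae_eq_mk n2 ρ t x hρ hρ1).trans (up ρ hρ))
  filter_upwards [ae_all_iff.2 main] with z hz R hR hR1
  calc ENNReal.ofReal (gradMag d Du z) ≤ ENNReal.ofReal (∑ i, |Du i z|) :=
        ENNReal.ofReal_le_ofReal (gradMag_le_sum Du z)
    _ = ∑ i, ‖Du i z‖ₑ := by
        rw [ENNReal.ofReal_sum_of_nonneg fun i _ => abs_nonneg _]
        simp only [Real.enorm_eq_ofReal_abs]
    _ ≤ ∑ _i : Fin d, _ := Finset.sum_le_sum fun i _ => hz i R hR hR1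
    _ = _ := by
        rw [Finset.sum_const, Finset.card_univ, Fintype.card_fin, nsmul_eq_mul, mul_add,
          sliceTruncPot, truncPot_const_mul (ENNReal.natCast_ne_top d)]
        congr 1
        · congr 1
          funext y
          rw [ENNReal.ofReal_mul (by positivity), ENNReal.ofReal_mul (by positivity),
            ENNReal.ofReal_natCast, mul_assoc]
        · rw [← ENNReal.ofReal_natCast, ← ENNReal.ofReal_mul (by positivity)]
          congr 1
          ring

end GradientBound

lemma add_rpow_le_two_rpow_mul (a b : ℝ≥0∞) {κ : ℝ} (hκ : 0 ≤ κ) :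
    (a + b) ^ κ ≤ 2 ^ κ * (a ^ κ + b ^ κ) := by
  rcases le_total a b with hab | hab
  · calc (a + b) ^ κ ≤ (2 * b) ^ κ := by rw [two_mul]; gcongr
      _ = 2 ^ κ * b ^ κ := ENNReal.mul_rpow_of_nonneg _ _ hκ
      _ ≤ _ := mul_le_mul' le_rfl le_add_self
  · calc (a + b) ^ κ ≤ (2 * a) ^ κ := by rw [two_mul]; gcongr
      _ = 2 ^ κ * a ^ κ := ENNReal.mul_rpow_of_nonneg _ _ hκ
      _ ≤ _ := mul_le_mul' le_rfl le_self_add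

lemma sum_rpow_le_card_rpow_mul {ι : Type*} (T : Finset ι) (z : ι → ℝ≥0∞) {κ : ℝ} (hκ : 0 < κ) :
    (∑ c ∈ T, z c) ^ κ ≤ (T.card : ℝ≥0∞) ^ κ * ∑ c ∈ T, z c ^ κ := by
  rcases T.eq_empty_or_nonempty with rfl | hT
  · simp [hκ]
  · obtain ⟨c, hc, hmax⟩ := T.exists_max_image z hT
    calc (∑ c ∈ T, z c) ^ κ ≤ (T.card * z c) ^ κ := by
          refine ENNReal.rpow_le_rpow ?_ hκ.le
          rw [← nsmul_eq_mul]
          exact Finset.sum_le_card_nsmul T z _ hmax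
      _ = (T.card : ℝ≥0∞) ^ κ * z c ^ κ := ENNReal.mul_rpow_of_nonneg _ _ hκ.le
      _ ≤ _ := mul_le_mul' le_rfl
          (Finset.single_le_sum (f := fun c => z c ^ κ) (fun _ _ => zero_le) hc)

lemma exists_finset_ball_subset (d : ℕ) :
    ∃ T : Finset (Spc d), ∀ (x : Spc d) (ρ : ℝ), 0 < ρ →
      ball x (2 * ρ) ⊆ ⋃ c ∈ T, ball (x + ρ • c) ρ := by
  obtain ⟨T, -, hTf, hT⟩ := (isCompact_closedBall (0 : Spc d) 2).finite_cover_balls one_pos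
  refine ⟨hTf.toFinset, fun x ρ hρ y hy => ?_⟩
  have hmem : ρ⁻¹ • (y - x) ∈ closedBall (0 : Spc d) 2 := by
    rw [mem_closedBall_zero_iff, norm_smul, norm_inv, Real.norm_of_nonneg hρ.le,
      inv_mul_le_iff₀ hρ, ← dist_eq_norm]
    linarith [mem_ball.1 hy]
  obtain ⟨c, hc, hyc⟩ := mem_iUnion₂.1 (hT hmem)
  refine mem_iUnion₂.2 ⟨c, by simpa using hc, ?_⟩
  rw [mem_ball, dist_eq_norm] at hyc ⊢
  have e : y - (x + ρ • c) = ρ • (ρ⁻¹ • (y - x) - c) := by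
    rw [smul_sub, smul_inv_smul₀ hρ.ne']
    abel
  rw [e, norm_smul, Real.norm_of_nonneg hρ.le]
  exact mul_lt_of_lt_one_right hρ hyc

lemma avgLpq_rpow {d : ℕ} {p q : ℝ} (hq : q ≠ 0) (ρ t : ℝ) (x : Spc d) (f : SpT d → ℝ) :
    avgLpq d p q ρ t x f ^ q = (∫⁻ τ in Ico t (t + ρ ^ 2),
      ((∫⁻ y in ball x ρ, ENNReal.ofReal |f (τ, y)| ^ p) / volume (ball x ρ)) ^ (q / p))
      / ENNReal.ofReal (ρ ^ 2) := by
  rw [avgLpq, ← ENNReal.rpow_mul, one_div, inv_mul_cancel₀ hq, ENNReal.rpow_one]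

lemma avgLpq_le_of_ae_slice_le {d : ℕ} {T : Finset (Spc d)} (hT : ∀ (x : Spc d) (ρ : ℝ), 0 < ρ →
      ball x (2 * ρ) ⊆ ⋃ c ∈ T, ball (x + ρ • c) ρ) {g a : SpT d → ℝ} (ha : Measurable a)
    {p q r s ρ t : ℝ} {x : Spc d} (hρ : 0 < ρ) (hp : 0 < p) (hq : 0 < q) (hs : 0 < s)
    (hsr : s / r = q / p) {X Y Z : ℝ≥0∞}
    (h : ∀ᵐ τ : ℝ, ∫⁻ y in ball x ρ, ENNReal.ofReal |g (τ, y)| ^ r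
      ≤ X * volume (ball x ρ) + Y * ∫⁻ y in ball x (2 * ρ), ENNReal.ofReal |a (τ, y)| ^ p)
    (hZ : ∀ x, avgLpq d p q ρ t x a ≤ Z) :
    avgLpq d r s ρ t x g ≤ (2 ^ (q / p) * (X ^ (q / p)
      + Y ^ (q / p) * ((T.card : ℝ≥0∞) ^ (q / p) * (T.card * Z ^ q)))) ^ (1 / s) := by
  set κ := q / p with hκ
  have hκ0 : 0 < κ := div_pos hq hp
  have hV : ∀ y : Spc d, volume (ball y ρ) = volume (ball x ρ) := fun y => by
    rw [Measure.addHaar_ball_center, ← Measure.addHaar_ball_center volume x]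
  have hV0 : volume (ball x ρ) ≠ 0 := (measure_ball_pos volume x hρ).ne'
  have hVt : volume (ball x ρ) ≠ ⊤ := measure_ball_lt_top.ne
  have hm : Measurable fun z : SpT d => ENNReal.ofReal |a z| ^ p :=
    (ENNReal.measurable_ofReal.comp (measurable_abs.comp ha)).pow_const p
  set m : Spc d → ℝ → ℝ≥0∞ := fun c τ => ((∫⁻ y in ball (x + ρ • c) ρ,
    ENNReal.ofReal |a (τ, y)| ^ p) / volume (ball (x + ρ • c) ρ)) ^ κ with hmdef
  have hmm : ∀ c, Measurable (m c) := fun c => by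
    have : Measurable fun τ : ℝ => ∫⁻ y in ball (x + ρ • c) ρ, ENNReal.ofReal |a (τ, y)| ^ p :=
      hm.lintegral_prod_right' (ν := volume.restrict (ball (x + ρ • c) ρ))
    exact (this.div_const _).pow_const _
  have slice : ∀ᵐ τ : ℝ, ((∫⁻ y in ball x ρ, ENNReal.ofReal |g (τ, y)| ^ r)
      / volume (ball x ρ)) ^ κ
      ≤ 2 ^ κ * (X ^ κ + Y ^ κ * ((T.card : ℝ≥0∞) ^ κ * ∑ c ∈ T, m c τ)) := by
    filter_upwards [h] with τ hτ
    have cover : (∫⁻ y in ball x (2 * ρ), ENNReal.ofReal |a (τ, y)| ^ p) / volume (ball x ρ)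
        ≤ ∑ c ∈ T, (∫⁻ y in ball (x + ρ • c) ρ, ENNReal.ofReal |a (τ, y)| ^ p)
          / volume (ball (x + ρ • c) ρ) := by
      simp only [hV, ENNReal.div_eq_inv_mul, ← Finset.mul_sum]
      refine mul_le_mul' le_rfl ((lintegral_mono_set (hT x ρ hρ)).trans ?_)
      rw [← Finset.tsum_subtype T fun c => ∫⁻ y in ball (x + ρ • c) ρ, ENNReal.ofReal |a (τ, y)| ^ p]
      rw [show ⋃ c ∈ T, ball (x + ρ • c) ρ = ⋃ c : {c // c ∈ T}, ball (x + ρ • (c : Spc d)) ρ by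
        ext; simp]
      exact lintegral_iUnion_le _ _
    calc ((∫⁻ y in ball x ρ, ENNReal.ofReal |g (τ, y)| ^ r) / volume (ball x ρ)) ^ κ
        ≤ (X + Y * ∑ c ∈ T, (∫⁻ y in ball (x + ρ • c) ρ, ENNReal.ofReal |a (τ, y)| ^ p)
          / volume (ball (x + ρ • c) ρ)) ^ κ := by
          refine ENNReal.rpow_le_rpow ?_ hκ0.le
          refine (ENNReal.div_le_div_right hτ _).trans ?_
          rw [ENNReal.add_div, ENNReal.mul_div_cancel_right hV0 hVt, mul_div_assoc]
          exact add_le_add le_rfl (mul_le_mul' le_rfl cover)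
      _ ≤ _ := by
          refine (add_rpow_le_two_rpow_mul _ _ hκ0.le).trans ?_
          rw [ENNReal.mul_rpow_of_nonneg _ _ hκ0.le]
          exact mul_le_mul' le_rfl (add_le_add le_rfl (mul_le_mul' le_rfl
            (sum_rpow_le_card_rpow_mul T _ hκ0)))
  have hR0 : ENNReal.ofReal (ρ ^ 2) ≠ 0 := by simp [hρ.ne']
  have hvol : volume (Ico t (t + ρ ^ 2)) = ENNReal.ofReal (ρ ^ 2) := by simp
  rw [avgLpq, hsr]
  refine ENNReal.rpow_le_rpow ?_ (by positivity)
  calc (∫⁻ τ in Ico t (t + ρ ^ 2), ((∫⁻ y in ball x ρ, ENNReal.ofReal |g (τ, y)| ^ r)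
        / volume (ball x ρ)) ^ κ) / ENNReal.ofReal (ρ ^ 2)
      ≤ (∫⁻ τ in Ico t (t + ρ ^ 2), 2 ^ κ * (X ^ κ + Y ^ κ * ((T.card : ℝ≥0∞) ^ κ
          * ∑ c ∈ T, m c τ))) / ENNReal.ofReal (ρ ^ 2) :=
        ENNReal.div_le_div_right (lintegral_mono_ae (ae_restrict_of_ae slice)) _
    _ = 2 ^ κ * (X ^ κ + Y ^ κ * ((T.card : ℝ≥0∞) ^ κ
          * ∑ c ∈ T, avgLpq d p q ρ t (x + ρ • c) a ^ q)) := by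
        have hsum : Measurable fun τ => ∑ c ∈ T, m c τ :=
          Finset.measurable_fun_sum _ fun c _ => hmm c
        have htot : Measurable fun τ =>
            X ^ κ + Y ^ κ * ((T.card : ℝ≥0∞) ^ κ * ∑ c ∈ T, m c τ) :=
          measurable_const.add ((hsum.const_mul _).const_mul _)
        rw [lintegral_const_mul _ htot,
          lintegral_add_left measurable_const, lintegral_const_mul _ (hsum.const_mul _),
          lintegral_const_mul _ hsum, lintegral_finsetSum _ fun c _ => hmm c, lintegral_const,
          Measure.restrict_apply_univ, hvol, mul_div_assoc, ENNReal.add_div,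
          ENNReal.mul_div_cancel_right hR0 ENNReal.ofReal_ne_top, mul_div_assoc, mul_div_assoc]
        simp only [avgLpq_rpow hq.ne', ENNReal.div_eq_inv_mul, Finset.mul_sum, hmdef, hκ]
    _ ≤ _ := by
        gcongr
        rw [← nsmul_eq_mul]
        exact Finset.sum_le_card_nsmul T _ _ fun c _ => ENNReal.rpow_le_rpow (hZ _) hq.le

lemma morrey_constant_eq {β p q r s κ C c D n K ρ : ℝ} (hβ : 1 < β) (hp : 0 < p) (hq : 0 < q)
    (hr : r = β * p / (β - 1)) (hs : s = β * q / (β - 1)) (hκ : κ = q / p) (hC : 0 ≤ C)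
    (hc : 0 ≤ c) (hD : 0 ≤ D) (hn : 0 ≤ n) (hK : 0 < K) (hρ : 0 < ρ) :
    (2 : ℝ≥0∞) ^ κ * (ENNReal.ofReal ((2 * (ρ ^ (1 - β) * (C * K))) ^ r) ^ κ
      + ENNReal.ofReal (c * (C * K) ^ (r - p) * D ^ p) ^ κ * (ENNReal.ofReal n ^ κ *
        (ENNReal.ofReal n * ENNReal.ofReal (K * ρ ^ (-β)) ^ q)))
      = ENNReal.ofReal (2 ^ κ * ((2 * C) ^ s + (c * C ^ (r - p) * D ^ p) ^ κ * (n ^ κ * n))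
          * (ρ ^ (1 - β) * K) ^ s) := by
  have hβ0 : 0 < β - 1 := sub_pos.2 hβ
  have hκ0 : 0 < κ := hκ ▸ div_pos hq hp
  have hrκ : r * κ = s := by rw [hr, hs, hκ]; field_simp
  have hpκ : (r - p) * κ + q = s := by rw [sub_mul, hrκ, hκ]; field_simp; ring
  have hβs : (1 - β) * s = -β * q := by rw [hs]; field_simp; ring
  have hr0 : 0 < r := by rw [hr]; positivity
  have e2 : (2 : ℝ≥0∞) = ENNReal.ofReal 2 := by simp
  have hL : 0 < ρ ^ (1 - β) := Real.rpow_pos_of_pos hρ _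
  have hL' : 0 < ρ ^ (-β) := Real.rpow_pos_of_pos hρ _
  have i1 : ((2 * (ρ ^ (1 - β) * (C * K))) ^ r) ^ κ = (2 * C) ^ s * (ρ ^ (1 - β) * K) ^ s := by
    rw [← Real.rpow_mul (by positivity), hrκ, ← Real.mul_rpow (by positivity) (by positivity)]
    congr 1
    ring
  have i2 : (c * (C * K) ^ (r - p) * D ^ p) ^ κ * (K * ρ ^ (-β)) ^ q
      = (c * C ^ (r - p) * D ^ p) ^ κ * (ρ ^ (1 - β) * K) ^ s := by
    rw [Real.mul_rpow hC hK.le, show c * (C ^ (r - p) * K ^ (r - p)) * D ^ p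
        = (c * C ^ (r - p) * D ^ p) * K ^ (r - p) by ring,
      Real.mul_rpow (by positivity) (by positivity), Real.mul_rpow hK.le hL'.le,
      Real.mul_rpow hL.le hK.le, ← Real.rpow_mul hK.le, ← Real.rpow_mul hρ.le,
      ← Real.rpow_mul hρ.le, hβs, ← hpκ, Real.rpow_add hK]
    ring
  rw [e2, ENNReal.ofReal_rpow_of_nonneg (by positivity) hκ0.le,
    ENNReal.ofReal_rpow_of_nonneg (by positivity) hκ0.le,
    ENNReal.ofReal_rpow_of_nonneg (by positivity) hκ0.le,
    ENNReal.ofReal_rpow_of_nonneg (by positivity) hκ0.le,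
    ENNReal.ofReal_rpow_of_nonneg (by positivity) hq.le,
    ← ENNReal.ofReal_mul (by positivity), ← ENNReal.ofReal_mul (by positivity),
    ← ENNReal.ofReal_mul (by positivity), ← ENNReal.ofReal_add (by positivity) (by positivity),
    ← ENNReal.ofReal_mul (by positivity), i1]
  congr 1
  linear_combination 2 ^ κ * n ^ κ * n * i2

lemma exists_morreyNorm_gradMag_le (d : ℕ) (hd : 1 ≤ d) {p q β : ℝ} (hp : 1 < p) (hq : 1 < q)
    (hβ : 1 < β) :
    ∃ N : ℝ, 0 < N ∧ ∀ (u : SpT d → ℝ) (Du : Fin d → SpT d → ℝ)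
      (D2u : Fin d → Fin d → SpT d → ℝ) (ut : SpT d → ℝ), Mem12 d p q β u Du D2u ut →
      ∀ K : ℝ, 0 < K → norm12 d p q β u Du D2u ut ≤ ENNReal.ofReal K →
      morreyNorm d (β * p / (β - 1)) (β * q / (β - 1)) (β - 1) (gradMag d Du)
        ≤ ENNReal.ofReal (N * K) := by
  obtain ⟨η, M, hM, hη⟩ := exists_isKernel d
  obtain ⟨T, hT⟩ := exists_finset_ball_subset d
  have hβ0 : 0 < β - 1 := sub_pos.2 hβ
  have hp0 : 0 < p := one_pos.trans hp
  have hq0 : 0 < q := one_pos.trans hq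
  have hd0 : (0 : ℝ) < d := by exact_mod_cast hd
  have hc₁ : 0 < volume.real (ball (0 : Spc d) 1) :=
    ENNReal.toReal_pos (measure_ball_pos volume _ one_pos).ne' measure_ball_lt_top.ne
  set C : ℝ := d * (2 ^ (β - 1) * (M * (2 + 3 / (β - 1)))
    * (d * volume.real (ball (0 : Spc d) 1))) with hC
  have hC0 : 0 < C := by positivity
  set r := β * p / (β - 1) with hr
  set s := β * q / (β - 1) with hs
  set κ := q / p with hκ
  have hr0 : 0 < r := by positivity
  have hs0 : 0 < s := by positivity
  set c := 4 * 2 ^ (r - 1 + (p - 1)) * ((β * (p - 1) + 1) / (β * (p - 1))) with hc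
  have hc0 : 0 < c := by
    have : 0 < p - 1 := sub_pos.2 hp
    positivity
  set B := 2 ^ κ * ((2 * C) ^ s
    + (c * C ^ (r - p) * (d * d : ℝ) ^ p) ^ κ * ((T.card : ℝ) ^ κ * T.card)) with hB
  have hB0 : 0 < B := by positivity
  refine ⟨B ^ (1 / s), by positivity, fun u Du D2u ut hu K hK hn => ?_⟩
  have hae : AEMeasurable (hessMag d D2u) volume :=
    aemeasurable_hessMag fun i j => (hu.2.2.2.2.2.1 i j).1
  set a := hae.mk with ha
  have ham : Measurable a := hae.measurable_mk
  have hea : hessMag d D2u =ᵐ[volume] a := hae.ae_eq_mk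
  have hna : morreyNorm d p q β a ≤ ENNReal.ofReal K := by
    rw [← morreyNorm_congr hea]
    exact (le_add_self.trans le_self_add).trans hn
  have hpt := ae_ofReal_gradMag_le_truncPot_add hη hd hp hq hβ hu hK.le hn ham hea
  rw [Measure.volume_eq_prod] at hpt
  have hsl := Measure.ae_ae_of_ae_prod hpt
  refine iSup_le fun ρ => iSup_le fun hρ => iSup_le fun hρ1 => iSup_le fun t => iSup_le fun x => ?_
  have hslice : ∀ᵐ τ : ℝ, ∫⁻ y in ball x ρ, ENNReal.ofReal |gradMag d Du (τ, y)| ^ r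
      ≤ ENNReal.ofReal ((2 * (ρ ^ (1 - β) * (C * K))) ^ r) * volume (ball x ρ)
        + ENNReal.ofReal (c * (C * K) ^ (r - p) * (d * d : ℝ) ^ p)
          * ∫⁻ y in ball x (2 * ρ), ENNReal.ofReal |a (τ, y)| ^ p := by
    filter_upwards [hsl] with τ hτ
    have hma : Measurable fun y : Spc d => d * d * |a (τ, y)| :=
      (measurable_abs.comp (ham.comp measurable_prodMk_left)).const_mul _
    have key := lintegral_rpow_le_of_forall_radius hη.measurable_ofReal hη.lintegral_ofReal
      (fun w hw => by rw [hη.eq_zero hw, ENNReal.ofReal_zero]) hp hβ (mul_pos hC0 hK) hρ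
      (g := fun y => gradMag d Du (τ, y)) (fun y => gradMag_nonneg Du _) hma
      (fun y => by positivity) x (by
        filter_upwards [hτ] with y hy R hR hRρ
        exact hy R hR (hRρ.trans hρ1))
    have e1 : ∀ y, ENNReal.ofReal |gradMag d Du (τ, y)| ^ r
        = ENNReal.ofReal (gradMag d Du (τ, y) ^ r) := fun y => by
      rw [abs_of_nonneg (gradMag_nonneg Du _),
        ENNReal.ofReal_rpow_of_nonneg (gradMag_nonneg Du _) hr0.le]
    have e2 : ∀ y, ENNReal.ofReal ((d * d * |a (τ, y)|) ^ p)
        = ENNReal.ofReal ((d * d : ℝ) ^ p) * ENNReal.ofReal |a (τ, y)| ^ p := fun y => by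
      rw [Real.mul_rpow (by positivity) (abs_nonneg _), ENNReal.ofReal_mul (by positivity),
        ENNReal.ofReal_rpow_of_nonneg (abs_nonneg _) hp0.le]
    simp only [e2, lintegral_const_mul' _ _ ENNReal.ofReal_ne_top] at key
    rw [← mul_assoc (ENNReal.ofReal _) (ENNReal.ofReal _), ← ENNReal.ofReal_mul (by positivity)] at key
    simpa only [e1] using key
  have hsr : s / r = q / p := by
    rw [hs, hr]
    field_simp
  have main := avgLpq_le_of_ae_slice_le hT ham hρ hp0 hq0 hs0 hsr hslice
    (fun y => avgLpq_le_of_morreyNorm_le hna hρ hρ1 t y)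
  rw [← ENNReal.ofReal_natCast, morrey_constant_eq hβ hp0 hq0 hr hs hκ hC0.le hc0.le
    (by positivity) (by positivity) hK hρ, ← hB] at main
  have hL : 0 < ρ ^ (1 - β) := Real.rpow_pos_of_pos hρ _
  calc ENNReal.ofReal (ρ ^ (β - 1)) * avgLpq d r s ρ t x (gradMag d Du)
      ≤ ENNReal.ofReal (ρ ^ (β - 1)) * ENNReal.ofReal (B * (ρ ^ (1 - β) * K) ^ s) ^ (1 / s) :=
        mul_le_mul' le_rfl main
    _ = ENNReal.ofReal (B ^ (1 / s) * K) := by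
        rw [ENNReal.ofReal_rpow_of_nonneg (by positivity) (by positivity),
          ← ENNReal.ofReal_mul (by positivity), Real.mul_rpow hB0.le (by positivity),
          ← Real.rpow_mul (by positivity), mul_one_div_cancel hs0.ne', Real.rpow_one]
        congr 1
        have : ρ ^ (β - 1) * ρ ^ (1 - β) = 1 := by
          rw [← Real.rpow_add hρ]
          simp
        linear_combination B ^ (1 / s) * K * this

/-- Lemma 3.27.5, embedding theorem: with
    `(r,s) = β(p,q)/(β-1)`, for every `u ∈ E^{1,2}_{p,q,β}` one has
    `‖Du‖_{E_{r,s,β-1}} ≤ N·‖u‖_{E^{1,2}_{p,q,β}}`. -/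
theorem statement9 (d : ℕ) (hd : 1 ≤ d) (p q β : ℝ)
    (hp : 1 < p) (hq : 1 < q) (hβ1 : 1 < β) (hβ : β ≤ (d : ℝ) / p + 2 / q) :
    ∃ N : ℝ≥0, ∀ (u : SpT d → ℝ) (Du : Fin d → SpT d → ℝ)
      (D2u : Fin d → Fin d → SpT d → ℝ) (ut : SpT d → ℝ),
      Mem12 d p q β u Du D2u ut →
      morreyNorm d (β * p / (β - 1)) (β * q / (β - 1)) (β - 1) (gradMag d Du) ≤
        N * norm12 d p q β u Du D2u ut := by
  obtain ⟨N, hN, h⟩ := exists_morreyNorm_gradMag_le d hd hp hq hβ1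
  refine ⟨N.toNNReal, fun u Du D2u ut hu => ?_⟩
  have hN0 : ((N.toNNReal : ℝ≥0) : ℝ≥0∞) ≠ 0 := by simpa using hN
  by_cases htop : norm12 d p q β u Du D2u ut = ⊤
  · rw [htop, ENNReal.mul_top hN0]
    exact le_top
  refine ENNReal.le_of_forall_pos_le_add fun ε hε _ => ?_
  have hε' : (0 : ℝ) < ε := hε
  set n := (norm12 d p q β u Du D2u ut).toReal with hn
  have hn0 : 0 ≤ n := ENNReal.toReal_nonneg
  refine (h u Du D2u ut hu (n + ε / N) (by positivity) ?_).trans ?_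
  · rw [← ENNReal.ofReal_toReal htop]
    exact ENNReal.ofReal_le_ofReal (le_add_of_nonneg_right (by positivity))
  · rw [mul_add, mul_div_cancel₀ _ hN.ne', ENNReal.ofReal_add (by positivity) hε'.le,
      ENNReal.ofReal_mul hN.le, hn, ENNReal.ofReal_toReal htop, ENNReal.ofReal_coe_nnreal]
    rfl
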